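/- Let B_j : ℝ^n → ℝ^{n_j} be C² submersions in a neighbourhood of 0 with BL(dB(0),p) < ∞, where p_j ∈ [0,1]. Fix α ∈ (1,2), β ∈ (0, 2−α), γ ∈ (0, min{(2−α−β)/((n+2)α), β/(2α)}), let N ∈ ℕ be the exponent guaranteed by the effective Lieb theorem (applied to the datum (dB(0),p)), and fix τ ∈ (0, γ/N) and σ ∈ (0, min{β − 2αγ, ατ}). Then there exists ν > 0 with the following property: if u ∈ U_ν(0), κ > 1, δ ∈ (0,ν) and μ > 0 satisfy δ^{α+β} > μ, then C(u,δ,μ,κ) ≤ (1 + δ^σ) · max_{x ∈ U_{2δ}(u)} C(x, δ^α, μ, κ·exp(δ^σ)). -/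

import Mathlib

open MeasureTheory
open scoped ENNReal Matrix

/-- The `ℓ² → ℓ²` operator norm of a matrix. -/
noncomputable def matOpNorm {a b : ℕ} (A : Matrix (Fin a) (Fin b) ℝ) : ℝ :=
  ‖LinearMap.toContinuousLinearMap (Matrix.toEuclideanLin A)‖

/-- The Brascamp–Lieb constant of the datum `(L, p)` on euclidean spaces. -/
noncomputable def BLe {m n : ℕ} (nj : Fin m → ℕ)
    (L : ∀ j, EuclideanSpace ℝ (Fin n) →L[ℝ] EuclideanSpace ℝ (Fin (nj j)))
    (p : Fin m → ℝ) : ℝ≥0∞ :=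
  sInf {C : ℝ≥0∞ | ∀ f : ∀ j, EuclideanSpace ℝ (Fin (nj j)) → ℝ≥0∞,
    (∀ j, Measurable (f j)) →
    ∫⁻ x, ∏ j, (f j (L j x)) ^ (p j) ≤ C * ∏ j, (∫⁻ xj, f j xj) ^ (p j)}

/-- The gaussian Brascamp–Lieb constant
`BL_g(L,p;A) = ∏_j det(A_j)^{p_j/2} / det(∑_j p_j L_j* A_j L_j)^{1/2}`. -/
noncomputable def matBLg {m n : ℕ} (nj : Fin m → ℕ)
    (L : ∀ j, Matrix (Fin (nj j)) (Fin n) ℝ) (p : Fin m → ℝ)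
    (A : ∀ j, Matrix (Fin (nj j)) (Fin (nj j)) ℝ) : ℝ :=
  (∏ j, (A j).det ^ (p j / 2)) / (∑ j, p j • ((L j)ᴴ * A j * L j)).det ^ ((1 : ℝ) / 2)

/-- The regularised and localised nonlinear Brascamp–Lieb constant `𝓒(u,δ,μ,κ)`:
the smallest `C ∈ [0,∞]` such that
`∫_{U_δ(u)} ∏_j f_j(B_j y)^{p_j} dy ≤ C ∏_j (∫ f_j)^{p_j}` for all inputs
`f_j ∈ L¹(B_j(U_{2δ}(u)); μ, κ)`, i.e. nonnegative integrable `f_j` that are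
`κ`-constant at scale `μ` on `B_j(U_{2δ}(u))`. -/
noncomputable def locC {m n : ℕ} (nj : Fin m → ℕ)
    (B : ∀ j, EuclideanSpace ℝ (Fin n) → EuclideanSpace ℝ (Fin (nj j)))
    (p : Fin m → ℝ) (u : EuclideanSpace ℝ (Fin n)) (δ μ κ : ℝ) : ℝ≥0∞ :=
  sInf {C : ℝ≥0∞ | ∀ f : ∀ j, EuclideanSpace ℝ (Fin (nj j)) → ℝ≥0∞,
    (∀ j, Measurable (f j)) → (∀ j, ∫⁻ z, f j z ≠ ⊤) →
    (∀ j, ∀ x ∈ B j '' Metric.closedBall u (2 * δ), ∀ y, dist x y ≤ μ →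
        f j x ≤ ENNReal.ofReal κ * f j y) →
    ∫⁻ y in Metric.closedBall u δ, ∏ j, (f j (B j y)) ^ (p j)
      ≤ C * ∏ j, (∫⁻ z, f j z) ^ (p j)}

section BrascampLieb

variable {m n : ℕ} {nj : Fin m → ℕ}

theorem le_sInf_mul_of_forall {S : Set ℝ≥0∞} {a X : ℝ≥0∞} (h : ∀ C ∈ S, a ≤ C * X)
    (hX : X ≠ ⊤) (h0 : X = 0 → a = 0) : a ≤ sInf S * X := by
  rcases eq_or_ne X 0 with hX0 | hX0
  · simp [h0 hX0]
  · rw [← ENNReal.div_le_iff hX0 hX]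
    exact le_sInf fun C hC => (ENNReal.div_le_iff hX0 hX).2 (h C hC)

theorem prod_lintegral_rpow_ne_top {p : Fin m → ℝ} (hp : ∀ j, 0 ≤ p j)
    {f : ∀ j, EuclideanSpace ℝ (Fin (nj j)) → ℝ≥0∞} (hf : ∀ j, ∫⁻ z, f j z ≠ ⊤) :
    ∏ j, (∫⁻ z, f j z) ^ (p j) ≠ ⊤ :=
  ENNReal.prod_ne_top fun j _ => ENNReal.rpow_ne_top_of_nonneg (hp j) (hf j)

/-- The Brascamp–Lieb inequality holds with the Brascamp–Lieb constant. -/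
theorem lintegral_prod_rpow_le_BLe {p : Fin m → ℝ} (hp : ∀ j, 0 ≤ p j)
    {L : ∀ j, EuclideanSpace ℝ (Fin n) →L[ℝ] EuclideanSpace ℝ (Fin (nj j))}
    (hL : BLe nj L p ≠ ⊤) {f : ∀ j, EuclideanSpace ℝ (Fin (nj j)) → ℝ≥0∞}
    (hfm : ∀ j, Measurable (f j)) (hf : ∀ j, ∫⁻ z, f j z ≠ ⊤) :
    ∫⁻ x, ∏ j, (f j (L j x)) ^ (p j) ≤ BLe nj L p * ∏ j, (∫⁻ xj, f j xj) ^ (p j) := by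
  refine le_sInf_mul_of_forall (fun C hC => hC f hfm) (prod_lintegral_rpow_ne_top hp hf) ?_
  intro h0
  obtain ⟨C, hC, -⟩ := sInf_lt_iff.1 (lt_top_iff_ne_top.2 hL)
  simpa [h0] using hC f hfm

/-- The localised inequality holds with the constant `locC`. -/
theorem lintegral_prod_rpow_le_locC {p : Fin m → ℝ} (hp : ∀ j, 0 ≤ p j)
    {B : ∀ j, EuclideanSpace ℝ (Fin n) → EuclideanSpace ℝ (Fin (nj j))}
    {u : EuclideanSpace ℝ (Fin n)} {δ μ κ : ℝ} (hδ : 0 ≤ δ) (hμ : 0 < μ)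
    {f : ∀ j, EuclideanSpace ℝ (Fin (nj j)) → ℝ≥0∞}
    (hfm : ∀ j, Measurable (f j)) (hf : ∀ j, ∫⁻ z, f j z ≠ ⊤)
    (hκ : ∀ j, ∀ x ∈ B j '' Metric.closedBall u (2 * δ), ∀ y, dist x y ≤ μ →
        f j x ≤ ENNReal.ofReal κ * f j y) :
    ∫⁻ y in Metric.closedBall u δ, ∏ j, (f j (B j y)) ^ (p j)
      ≤ locC nj B p u δ μ κ * ∏ j, (∫⁻ z, f j z) ^ (p j) := by
  refine le_sInf_mul_of_forall (fun C hC => hC f hfm hf hκ)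
    (prod_lintegral_rpow_ne_top hp hf) ?_
  intro h0
  obtain ⟨j, -, hj⟩ := Finset.prod_eq_zero_iff.1 h0
  have hj' : ∫⁻ z, f j z = 0 ∧ 0 < p j := by
    rcases ENNReal.rpow_eq_zero_iff.1 hj with h | h
    · exact h
    · exact absurd h.1 (hf j)
  have hz : ∀ y ∈ Metric.closedBall u δ, f j (B j y) = 0 := by
    intro y hy
    have hmem : B j y ∈ B j '' Metric.closedBall u (2 * δ) :=
      ⟨y, Metric.closedBall_subset_closedBall (by linarith) hy, rfl⟩
    have h1 : ∫⁻ _ in Metric.closedBall (B j y) μ, f j (B j y) ≤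
        ENNReal.ofReal κ * ∫⁻ z, f j z := by
      rw [← lintegral_const_mul _ (hfm j)]
      refine le_trans (setLIntegral_mono' measurableSet_closedBall ?_)
        (setLIntegral_le_lintegral (Metric.closedBall (B j y) μ) _)
      intro z hz
      exact hκ j _ hmem z (by rw [dist_comm]; exact hz)
    rw [hj'.1, mul_zero, setLIntegral_const, nonpos_iff_eq_zero, mul_eq_zero] at h1
    exact h1.resolve_right (Metric.measure_closedBall_pos volume _ hμ).ne'
  rw [setLIntegral_congr_fun (g := fun _ => 0) measurableSet_closedBall]
  · simp
  · intro y hy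
    refine Finset.prod_eq_zero (Finset.mem_univ j) ?_
    rw [hz y hy, ENNReal.zero_rpow_of_pos hj'.2]

theorem measurable_prod_rpow {X : Type*} [MeasurableSpace X] {p : Fin m → ℝ}
    {f : ∀ j, EuclideanSpace ℝ (Fin (nj j)) → ℝ≥0∞} (hf : ∀ j, Measurable (f j))
    {T : ∀ j, X → EuclideanSpace ℝ (Fin (nj j))} (hT : ∀ j, Measurable (T j)) :
    Measurable fun x => ∏ j, (f j (T j x)) ^ (p j) :=
  Finset.measurable_prod _ fun j _ => ((hf j).comp (hT j)).pow_const _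

theorem lintegral_lintegral_mul_sub {d : ℕ} {F G : EuclideanSpace ℝ (Fin d) → ℝ≥0∞}
    (hF : Measurable F) (hG : Measurable G) (c : EuclideanSpace ℝ (Fin d)) :
    ∫⁻ z, ∫⁻ y, F y * G (z + c - y) = (∫⁻ y, F y) * ∫⁻ x, G x := by
  rw [lintegral_lintegral_swap, ← lintegral_mul_const _ hF]
  · refine lintegral_congr fun y => ?_
    rw [lintegral_const_mul _ (by fun_prop)]
    congr 1
    simp_rw [add_sub_assoc]
    exact lintegral_add_right_eq_self (fun z => G z) (c - y)
  · exact Measurable.aemeasurable (by simp only [Function.uncurry_def]; fun_prop)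

theorem prod_mul_rpow_le {p : Fin m → ℝ} (hp : ∀ j, p j ∈ Set.Icc (0 : ℝ) 1) {ε : ℝ} (hε : 0 ≤ ε)
    {a b : Fin m → ℝ≥0∞} (h : ∀ j, a j ≤ ENNReal.ofReal (Real.exp ε) * b j) :
    ∏ j, a j ^ p j ≤ ENNReal.ofReal (Real.exp (m * ε)) * ∏ j, b j ^ p j := by
  have h1 : (1 : ℝ≥0∞) ≤ ENNReal.ofReal (Real.exp ε) := by
    rw [← ENNReal.ofReal_one]; exact ENNReal.ofReal_le_ofReal (Real.one_le_exp hε)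
  calc ∏ j, a j ^ p j ≤ ∏ j, (ENNReal.ofReal (Real.exp ε) * b j ^ p j) := by
        refine Finset.prod_le_prod' fun j _ => ?_
        refine (ENNReal.rpow_le_rpow (h j) (hp j).1).trans ?_
        rw [ENNReal.mul_rpow_of_nonneg _ _ (hp j).1]
        gcongr
        exact (ENNReal.rpow_le_rpow_of_exponent_le h1 (hp j).2).trans_eq (ENNReal.rpow_one _)
    _ = _ := by
        rw [Finset.prod_mul_distrib, Finset.prod_const, Finset.card_univ, Fintype.card_fin,
          ← ENNReal.ofReal_pow (Real.exp_pos _).le, ← Real.exp_nat_mul]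

/-- One step of the induction on scales, for a kernel `g` which varies slowly at scale `d` and for
which the linear Brascamp–Lieb inequality is nearly sharp when localised to scale `r`. -/
theorem lintegral_prod_rpow_le_of_kernel {p : Fin m → ℝ} (hp : ∀ j, p j ∈ Set.Icc (0 : ℝ) 1)
    {B : ∀ j, EuclideanSpace ℝ (Fin n) → EuclideanSpace ℝ (Fin (nj j))}
    {L : ∀ j, EuclideanSpace ℝ (Fin n) →L[ℝ] EuclideanSpace ℝ (Fin (nj j))}
    (hL : BLe nj L p ≠ ⊤) (hL0 : BLe nj L p ≠ 0)
    {u : EuclideanSpace ℝ (Fin n)} {δ r μ κ ε ε' ρ d : ℝ} {c S : ℝ≥0∞}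
    (hr : 0 < r) (hrδ : 3 * r ≤ δ) (hμ : 0 < μ) (hμd : μ ≤ d) (hdρ : d ≤ ρ) (hε : 0 ≤ ε) (hε' : ε ≤ ε')
    (hκ : 0 ≤ κ)
    (hBc : ∀ j, ContinuousOn (B j) (Metric.closedBall u δ))
    (hB1 : ∀ j, ∀ z ∈ Metric.closedBall u (δ + r), ∀ y ∈ Metric.closedBall z (2 * r),
      ‖B j z - B j y‖ + μ ≤ ρ)
    (hB2 : ∀ j, ∀ z ∈ Metric.closedBall u (δ + r), ∀ y ∈ Metric.closedBall z r,
      ‖B j z - B j y - L j (z - y)‖ ≤ d)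
    (hB3 : ∀ j, ∀ z ∈ Metric.closedBall u (δ + r), ‖B j z - B j u - L j (z - u)‖ ≤ d)
    (hLr : ∀ j, ∀ x ∈ Metric.closedBall 0 r, ‖L j x‖ ≤ ρ)
    {g : ∀ j, EuclideanSpace ℝ (Fin (nj j)) → ℝ≥0∞} (hgm : ∀ j, Measurable (g j))
    (hg0 : ∀ j, ∫⁻ x, g j x ≠ 0) (hgt : ∀ j, ∫⁻ x, g j x ≠ ⊤)
    (hg1 : ∀ j x, g j x ≤ 1)
    (hg : ∀ j a b, ‖a‖ ≤ ρ → ‖b‖ ≤ 2 * ρ → ‖a - b‖ ≤ d →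
      g j a ≤ ENNReal.ofReal (Real.exp ε) * g j b)
    (hgL : c * (BLe nj L p * ∏ j, (∫⁻ x, g j x) ^ p j) ≤
      ∫⁻ x in Metric.closedBall 0 r, ∏ j, (g j (L j x)) ^ p j)
    (hS : ∀ z ∈ Metric.closedBall u (2 * δ), locC nj B p z r μ (κ * Real.exp ε') ≤ S)
    {f : ∀ j, EuclideanSpace ℝ (Fin (nj j)) → ℝ≥0∞} (hfm : ∀ j, Measurable (f j))
    (hft : ∀ j, ∫⁻ z, f j z ≠ ⊤)
    (hfκ : ∀ j, ∀ x ∈ B j '' Metric.closedBall u (2 * δ), ∀ y, dist x y ≤ μ →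
        f j x ≤ ENNReal.ofReal κ * f j y) :
    c * ∫⁻ y in Metric.closedBall u δ, ∏ j, (f j (B j y)) ^ (p j)
      ≤ ENNReal.ofReal (Real.exp (2 * m * ε)) * S * ∏ j, (∫⁻ z, f j z) ^ (p j) := by
  classical
  have hp0 : ∀ j, 0 ≤ p j := fun j => (hp j).1
  set Y : ℝ≥0∞ := BLe nj L p * ∏ j, (∫⁻ x, g j x) ^ p j with hY
  have hYt : Y ≠ ⊤ := ENNReal.mul_ne_top hL (prod_lintegral_rpow_ne_top hp0 hgt)
  have hY0 : Y ≠ 0 := mul_ne_zero hL0 <| Finset.prod_ne_zero_iff.2 fun j _ => by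
    rw [Ne, ENNReal.rpow_eq_zero_iff]
    rintro (h | h)
    · exact hg0 j h.1
    · exact hgt j h.1
  -- measurable versions of the two integrands
  set T : ∀ j, EuclideanSpace ℝ (Fin n) → EuclideanSpace ℝ (Fin (nj j)) :=
    fun j => (Metric.closedBall u δ).piecewise (B j) fun _ => 0 with hT
  have hTm : ∀ j, Measurable (T j) := fun j =>
    (hBc j).measurable_piecewise continuousOn_const measurableSet_closedBall
  set F : EuclideanSpace ℝ (Fin n) → ℝ≥0∞ :=
    (Metric.closedBall u δ).indicator fun y => ∏ j, (f j (T j y)) ^ p j with hF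
  have hFm : Measurable F := (measurable_prod_rpow hfm hTm).indicator measurableSet_closedBall
  have hFB : ∀ y ∈ Metric.closedBall u δ, F y = ∏ j, (f j (B j y)) ^ p j := by
    intro y hy
    simp only [hF, hT, Set.indicator_of_mem hy, Set.piecewise_eq_of_mem _ _ _ hy]
  have hFint : ∫⁻ y, F y = ∫⁻ y in Metric.closedBall u δ, ∏ j, (f j (B j y)) ^ p j := by
    rw [hF, lintegral_indicator measurableSet_closedBall]
    refine setLIntegral_congr_fun measurableSet_closedBall fun y hy => ?_
    simp only [hT, Set.piecewise_eq_of_mem _ _ _ hy]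
  set G : EuclideanSpace ℝ (Fin n) → ℝ≥0∞ :=
    (Metric.closedBall 0 r).indicator fun x => ∏ j, (g j (L j x)) ^ p j with hG
  have hGm : Measurable G := (measurable_prod_rpow hgm
    fun j => (L j).continuous.measurable).indicator measurableSet_closedBall
  have hGint : ∫⁻ x, G x = ∫⁻ x in Metric.closedBall 0 r, ∏ j, (g j (L j x)) ^ p j :=
    lintegral_indicator measurableSet_closedBall _
  -- the convolutions
  set H : ∀ j, EuclideanSpace ℝ (Fin (nj j)) → ℝ≥0∞ :=
    fun j v => ∫⁻ w, f j w * g j (v + (B j u - L j u) - w) with hH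
  have hHm : ∀ j, Measurable (H j) := fun j => by
    have h1 : Measurable fun q : EuclideanSpace ℝ (Fin (nj j)) × EuclideanSpace ℝ (Fin (nj j)) =>
        f j q.2 * g j (q.1 + (B j u - L j u) - q.2) := by
      have := hfm j
      have := hgm j
      fun_prop
    exact h1.lintegral_prod_right'
  have hHint : ∀ j, ∫⁻ v, H j v = (∫⁻ w, f j w) * ∫⁻ x, g j x := fun j =>
    lintegral_lintegral_mul_sub (hfm j) (hgm j) _
  have key : ∀ z, ∫⁻ y, F y * G (z + 0 - y) ≤
      ENNReal.ofReal (Real.exp (2 * m * ε)) * S * ∏ j, (H j (L j z)) ^ p j := by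
    intro z
    rw [add_zero]
    by_cases hz : z ∈ Metric.closedBall u (δ + r)
    swap
    · refine le_of_eq_of_le ?_ zero_le
      rw [lintegral_eq_zero_iff (by fun_prop)]
      refine Filter.Eventually.of_forall fun y => ?_
      simp only [Pi.zero_apply, mul_eq_zero]
      by_contra hcon
      push Not at hcon
      have h1 : y ∈ Metric.closedBall u δ := Set.mem_of_indicator_ne_zero hcon.1
      have h2 : z - y ∈ Metric.closedBall (0 : EuclideanSpace ℝ (Fin n)) r :=
        Set.mem_of_indicator_ne_zero hcon.2
      rw [mem_closedBall_zero_iff, ← dist_eq_norm] at h2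
      refine hz (Metric.mem_closedBall.2 ?_)
      have := dist_triangle z y u
      have := Metric.mem_closedBall.1 h1
      linarith
    set h : ∀ j, EuclideanSpace ℝ (Fin (nj j)) → ℝ≥0∞ := fun j w =>
      f j w * (Metric.closedBall (B j z) ρ).indicator (fun w => g j (B j z - w)) w with hh
    have hhm : ∀ j, Measurable (h j) := fun j =>
      (hfm j).mul (((hgm j).comp (by fun_prop)).indicator measurableSet_closedBall)
    have hh_le : ∀ j, ∫⁻ w, h j w ≤ ENNReal.ofReal (Real.exp ε) * H j (L j z) := by
      intro j
      have h3 := hB3 j z hz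
      have hm : Measurable fun w => f j w * g j (L j z + (B j u - L j u) - w) := by
        have := hfm j
        have := hgm j
        fun_prop
      rw [hH]
      simp only
      rw [← lintegral_const_mul _ hm]
      refine lintegral_mono fun w => ?_
      simp only [hh]
      by_cases hw : w ∈ Metric.closedBall (B j z) ρ
      · rw [Set.indicator_of_mem hw, mul_left_comm]
        gcongr
        have hn : ‖B j z - w‖ ≤ ρ := by
          rw [← dist_eq_norm, dist_comm]; exact hw
        have he : B j z - w - (L j z + (B j u - L j u) - w) =
            B j z - B j u - L j (z - u) := by rw [map_sub]; abel
        refine hg j _ _ hn ?_ (by rw [he]; exact h3)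
        have : L j z + (B j u - L j u) - w = (B j z - w) - (B j z - B j u - L j (z - u)) := by
          rw [map_sub]; abel
        rw [this]
        refine (norm_sub_le _ _).trans ?_
        linarith
      · rw [Set.indicator_of_notMem hw]; simp
    have hzδ : z ∈ Metric.closedBall u (2 * δ) :=
      Metric.closedBall_subset_closedBall (by linarith) hz
    have hh_fin : ∀ j, ∫⁻ w, h j w ≠ ⊤ := by
      intro j
      refine ne_top_of_le_ne_top (hft j) (lintegral_mono fun w => ?_)
      refine (mul_le_mul_right (Set.indicator_le_self' (fun _ _ => zero_le) w) _).trans ?_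
      exact mul_le_of_le_one_right' (hg1 j _)
    have hhκ : ∀ j, ∀ x ∈ B j '' Metric.closedBall z (2 * r), ∀ y, dist x y ≤ μ →
        h j x ≤ ENNReal.ofReal (κ * Real.exp ε') * h j y := by
      rintro j _ ⟨x, hx, rfl⟩ y hy
      have h1 := hB1 j z hz x hx
      have hxu : x ∈ Metric.closedBall u (2 * δ) := by
        have := dist_triangle x z u
        rw [Metric.mem_closedBall] at *
        linarith
      have hy1 : ‖B j x - y‖ ≤ μ := by rwa [← dist_eq_norm]
      have hyz : ‖B j z - y‖ ≤ ρ := by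
        have : B j z - y = (B j z - B j x) + (B j x - y) := by abel
        rw [this]
        refine (norm_add_le _ _).trans ?_
        linarith
      have hxm : B j x ∈ Metric.closedBall (B j z) ρ := by
        rw [Metric.mem_closedBall, dist_comm, dist_eq_norm]; linarith
      have hym : y ∈ Metric.closedBall (B j z) ρ := by
        rwa [Metric.mem_closedBall, dist_comm, dist_eq_norm]
      simp only [hh, Set.indicator_of_mem hxm, Set.indicator_of_mem hym]
      rw [ENNReal.ofReal_mul hκ, mul_mul_mul_comm]
      refine mul_le_mul' (hfκ j _ ⟨x, hxu, rfl⟩ y hy) ((hg j _ _ (by linarith) ?_ ?_).trans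
        (by gcongr))
      · linarith [norm_nonneg (B j z - y)]
      · have : B j z - B j x - (B j z - y) = -(B j x - y) := by abel
        rw [this, norm_neg]; linarith
    have hinner : ∫⁻ y, F y * G (z - y) ≤ ENNReal.ofReal (Real.exp (m * ε)) *
        ∫⁻ y in Metric.closedBall z r, ∏ j, (h j (B j y)) ^ p j := by
      rw [← lintegral_const_mul' _ _ ENNReal.ofReal_ne_top,
        ← lintegral_indicator measurableSet_closedBall]
      refine lintegral_mono fun y => ?_
      by_cases hy : y ∈ Metric.closedBall u δ
      swap
      · simp [hF, Set.indicator_of_notMem hy]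
      by_cases hyz : y ∈ Metric.closedBall z r
      swap
      · have : z - y ∉ Metric.closedBall (0 : EuclideanSpace ℝ (Fin n)) r := by
          rwa [mem_closedBall_zero_iff, ← dist_eq_norm, dist_comm]
        simp [hG, Set.indicator_of_notMem this]
      have hzy : z - y ∈ Metric.closedBall (0 : EuclideanSpace ℝ (Fin n)) r := by
        rwa [mem_closedBall_zero_iff, ← dist_eq_norm, dist_comm]
      rw [Set.indicator_of_mem hyz, hFB y hy]
      simp only [hG, Set.indicator_of_mem hzy]
      rw [← Finset.prod_mul_distrib]
      simp_rw [← ENNReal.mul_rpow_of_nonneg _ _ (hp0 _)]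
      refine prod_mul_rpow_le hp hε fun j => ?_
      have h1 := hB1 j z hz y (Metric.closedBall_subset_closedBall (by linarith) hyz)
      have hym : B j y ∈ Metric.closedBall (B j z) ρ := by
        rw [Metric.mem_closedBall, dist_comm, dist_eq_norm]; linarith
      simp only [hh, Set.indicator_of_mem hym]
      rw [mul_left_comm]
      gcongr
      refine hg j _ _ (hLr j _ hzy) (by linarith [norm_nonneg (B j z - B j y)]) ?_
      rw [norm_sub_rev]
      exact hB2 j z hz y hyz
    calc ∫⁻ y, F y * G (z - y) ≤ _ := hinner
      _ ≤ ENNReal.ofReal (Real.exp (m * ε)) * (S * ∏ j, (∫⁻ w, h j w) ^ p j) := by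
          gcongr
          refine (lintegral_prod_rpow_le_locC hp0 hr.le hμ hhm hh_fin hhκ).trans ?_
          gcongr
          exact hS z hzδ
      _ ≤ ENNReal.ofReal (Real.exp (m * ε)) *
          (S * (ENNReal.ofReal (Real.exp (m * ε)) * ∏ j, (H j (L j z)) ^ p j)) := by
          gcongr
          exact prod_mul_rpow_le hp hε hh_le
      _ = _ := by
          have : Real.exp (2 * m * ε) = Real.exp (m * ε) * Real.exp (m * ε) := by
            rw [← Real.exp_add]; ring_nf
          rw [this, ENNReal.ofReal_mul (Real.exp_pos _).le]
          ring
  have hmain : (∫⁻ y, F y) * ∫⁻ x, G x ≤ ENNReal.ofReal (Real.exp (2 * m * ε)) * S *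
      (Y * ∏ j, (∫⁻ z, f j z) ^ (p j)) := by
    rw [← lintegral_lintegral_mul_sub hFm hGm 0]
    refine (lintegral_mono key).trans ?_
    rw [lintegral_const_mul _ (measurable_prod_rpow hHm fun j => (L j).continuous.measurable)]
    gcongr
    refine (lintegral_prod_rpow_le_BLe hp0 hL hHm ?_).trans_eq ?_
    · intro j
      rw [hHint]
      exact ENNReal.mul_ne_top (hft j) (hgt j)
    · simp_rw [hHint, ENNReal.mul_rpow_of_nonneg _ _ (hp0 _)]
      rw [Finset.prod_mul_distrib, hY]
      ring
  rw [← hFint]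
  rw [← hGint] at hgL
  have : Y * (c * ∫⁻ y, F y) ≤ Y * (ENNReal.ofReal (Real.exp (2 * m * ε)) * S *
      ∏ j, (∫⁻ z, f j z) ^ (p j)) := by
    calc Y * (c * ∫⁻ y, F y) = (∫⁻ y, F y) * (c * Y) := by ring
      _ ≤ (∫⁻ y, F y) * ∫⁻ x, G x := by gcongr
      _ ≤ _ := hmain
      _ = _ := by ring
  exact (ENNReal.mul_le_mul_iff_right hY0 hYt).1 this

end BrascampLieb

section Gaussian

/-- The centred gaussian `x ↦ exp (-π ⟨x, A x⟩)`. -/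
noncomputable def gaussDensity {d : ℕ} (A : Matrix (Fin d) (Fin d) ℝ)
    (x : EuclideanSpace ℝ (Fin d)) : ℝ≥0∞ :=
  ENNReal.ofReal (Real.exp (-(Real.pi * inner ℝ x (Matrix.toEuclideanLin A x))))

variable {d : ℕ}

theorem measurable_gaussDensity (A : Matrix (Fin d) (Fin d) ℝ) : Measurable (gaussDensity A) := by
  have h : Continuous fun x => Matrix.toEuclideanLin A x :=
    LinearMap.continuous_of_finiteDimensional _
  have h2 : Continuous fun x => inner ℝ x (Matrix.toEuclideanLin A x) := continuous_id.inner h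
  exact (Real.continuous_exp.comp (continuous_const.mul h2).neg).measurable.ennreal_ofReal

theorem toEuclideanLin_mul {a b c : ℕ} (A : Matrix (Fin a) (Fin b) ℝ)
    (B : Matrix (Fin b) (Fin c) ℝ) (x : EuclideanSpace ℝ (Fin c)) :
    Matrix.toEuclideanLin (A * B) x = Matrix.toEuclideanLin A (Matrix.toEuclideanLin B x) := by
  simp [Matrix.toLpLin_apply, Matrix.mulVec_mulVec]

theorem inner_toEuclideanLin_conjTranspose {a b : ℕ} (A : Matrix (Fin a) (Fin b) ℝ)
    (x : EuclideanSpace ℝ (Fin b)) (y : EuclideanSpace ℝ (Fin a)) :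
    inner ℝ x (Matrix.toEuclideanLin Aᴴ y) = inner ℝ (Matrix.toEuclideanLin A x) y := by
  rw [Matrix.toEuclideanLin_conjTranspose_eq_adjoint, LinearMap.adjoint_inner_right]

theorem inner_toEuclideanLin_pos {M : Matrix (Fin d) (Fin d) ℝ} (hM : M.PosDef)
    {x : EuclideanSpace ℝ (Fin d)} (hx : x ≠ 0) : 0 < inner ℝ x (Matrix.toEuclideanLin M x) := by
  have h := hM.dotProduct_mulVec_pos (x := x.ofLp) (by simpa using hx)
  have h2 := Matrix.inner_toEuclideanCLM M x x
  rw [← Matrix.coe_toEuclideanCLM_eq_toEuclideanLin]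
  simpa [h2] using h

theorem inner_toEuclideanLin_nonneg {M : Matrix (Fin d) (Fin d) ℝ} (hM : M.PosDef)
    (x : EuclideanSpace ℝ (Fin d)) : 0 ≤ inner ℝ x (Matrix.toEuclideanLin M x) := by
  rcases eq_or_ne x 0 with rfl | hx
  · simp
  · exact (inner_toEuclideanLin_pos hM hx).le

theorem gaussDensity_le_one {M : Matrix (Fin d) (Fin d) ℝ} (hM : M.PosDef)
    (x : EuclideanSpace ℝ (Fin d)) : gaussDensity M x ≤ 1 := by
  rw [gaussDensity, ← ENNReal.ofReal_one]
  refine ENNReal.ofReal_le_ofReal (Real.exp_le_one_iff.2 ?_)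
  have := mul_nonneg Real.pi_pos.le (inner_toEuclideanLin_nonneg hM x)
  linarith

theorem norm_toEuclideanLin_le {a b : ℕ} (A : Matrix (Fin a) (Fin b) ℝ)
    (x : EuclideanSpace ℝ (Fin b)) : ‖Matrix.toEuclideanLin A x‖ ≤ matOpNorm A * ‖x‖ :=
  (LinearMap.toContinuousLinearMap (Matrix.toEuclideanLin A)).le_opNorm x

theorem matOpNorm_nonneg {a b : ℕ} (A : Matrix (Fin a) (Fin b) ℝ) : 0 ≤ matOpNorm A :=
  norm_nonneg _

theorem inner_sub_inner_le (A : Matrix (Fin d) (Fin d) ℝ) (a b : EuclideanSpace ℝ (Fin d)) :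
    inner ℝ b (Matrix.toEuclideanLin A b) - inner ℝ a (Matrix.toEuclideanLin A a) ≤
      matOpNorm A * ‖a - b‖ * (‖a‖ + ‖b‖) := by
  have h : inner ℝ b (Matrix.toEuclideanLin A b) - inner ℝ a (Matrix.toEuclideanLin A a) =
      inner ℝ (b - a) (Matrix.toEuclideanLin A b) +
        inner ℝ a (Matrix.toEuclideanLin A (b - a)) := by
    rw [map_sub, inner_sub_left, inner_sub_right]; ring
  rw [h, norm_sub_rev]
  have h1 := (real_inner_le_norm (b - a) (Matrix.toEuclideanLin A b)).trans
    (mul_le_mul_of_nonneg_left (norm_toEuclideanLin_le A b) (norm_nonneg _))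
  have h2 := (real_inner_le_norm a (Matrix.toEuclideanLin A (b - a))).trans
    (mul_le_mul_of_nonneg_left (norm_toEuclideanLin_le A (b - a)) (norm_nonneg _))
  linarith

theorem norm_sq_le_mul_inner {A : Matrix (Fin d) (Fin d) ℝ} (hA : A.PosDef) {K : ℝ} (hK0 : 0 < K)
    (hK : matOpNorm A⁻¹ ≤ K) (x : EuclideanSpace ℝ (Fin d)) :
    ‖x‖ ^ 2 ≤ K * inner ℝ x (Matrix.toEuclideanLin A x) := by
  set w := Matrix.toEuclideanLin A⁻¹ x with hw
  have hAw : Matrix.toEuclideanLin A w = x := by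
    rw [hw, ← toEuclideanLin_mul, Matrix.mul_nonsing_inv _ ((Matrix.isUnit_iff_isUnit_det _).1
      hA.isUnit)]
    simp
  have h1 := inner_toEuclideanLin_nonneg hA (K • x - w)
  have hsymm : inner ℝ w (Matrix.toEuclideanLin A x) = ‖x‖ ^ 2 := by
    have h := inner_toEuclideanLin_conjTranspose A w x
    rw [hA.1.eq, hAw, real_inner_self_eq_norm_sq] at h
    exact h
  have hwx : inner ℝ w x ≤ K * ‖x‖ ^ 2 := by
    refine (real_inner_le_norm _ _).trans ?_
    have := norm_toEuclideanLin_le A⁻¹ x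
    rw [← hw] at this
    nlinarith [norm_nonneg x, mul_le_mul_of_nonneg_right hK (norm_nonneg x)]
  rw [map_sub, map_smul, hAw, inner_sub_left, inner_sub_right, inner_sub_right, inner_smul_left,
    inner_smul_left, inner_smul_right, inner_smul_right, hsymm, real_inner_self_eq_norm_sq] at h1
  simp only [conj_trivial] at h1
  have h2 : 0 ≤ K * (K * inner ℝ x (Matrix.toEuclideanLin A x) - ‖x‖ ^ 2) := by nlinarith
  have := nonneg_of_mul_nonneg_right h2 hK0
  linarith

open scoped MatrixOrder Matrix.Norms.L2Operator in
theorem exists_eq_conjTranspose_mul_self {M : Matrix (Fin d) (Fin d) ℝ} (hM : M.PosDef) :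
    ∃ Y : Matrix (Fin d) (Fin d) ℝ, M = Yᴴ * Y :=
  CStarAlgebra.nonneg_iff_eq_star_mul_self.mp hM.posSemidef.nonneg

theorem lintegral_exp_neg_pi_norm_sq :
    ∫⁻ x : EuclideanSpace ℝ (Fin d), ENNReal.ofReal (Real.exp (-(Real.pi * ‖x‖ ^ 2))) = 1 := by
  have h := GaussianFourier.integral_rexp_neg_mul_sq_norm (V := EuclideanSpace ℝ (Fin d))
    Real.pi_pos
  rw [div_self Real.pi_pos.ne', Real.one_rpow] at h
  simp_rw [neg_mul] at h
  rw [← ofReal_integral_eq_lintegral_ofReal ?_ ?_, h, ENNReal.ofReal_one]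
  · exact Integrable.of_integral_ne_zero (by rw [h]; norm_num)
  · exact Filter.Eventually.of_forall fun x => (Real.exp_pos _).le

theorem lintegral_gaussDensity {M : Matrix (Fin d) (Fin d) ℝ} (hM : M.PosDef) :
    ∫⁻ x, gaussDensity M x = ENNReal.ofReal (M.det ^ ((1 : ℝ) / 2))⁻¹ := by
  obtain ⟨Y, rfl⟩ := exists_eq_conjTranspose_mul_self hM
  have hdet : (Yᴴ * Y).det = |Y.det| ^ 2 := by
    rw [Matrix.det_mul, Matrix.det_conjTranspose, sq_abs, sq]; simp
  have hpos := hM.det_pos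
  have hY : LinearMap.det (Matrix.toEuclideanLin Y) ≠ 0 := by
    rw [LinearMap.det_toLpLin]
    rintro h
    rw [hdet, h] at hpos
    simp at hpos
  have hm : Measurable fun v : EuclideanSpace ℝ (Fin d) =>
      ENNReal.ofReal (Real.exp (-(Real.pi * ‖v‖ ^ 2))) := by fun_prop
  have hYm : Measurable fun x => Matrix.toEuclideanLin Y x :=
    (LinearMap.continuous_of_finiteDimensional _).measurable
  calc ∫⁻ x, gaussDensity (Yᴴ * Y) x
      = ∫⁻ x, ENNReal.ofReal (Real.exp (-(Real.pi * ‖Matrix.toEuclideanLin Y x‖ ^ 2))) := by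
        refine lintegral_congr fun x => ?_
        rw [gaussDensity, toEuclideanLin_mul, inner_toEuclideanLin_conjTranspose,
          real_inner_self_eq_norm_sq]
    _ = ∫⁻ v, ENNReal.ofReal (Real.exp (-(Real.pi * ‖v‖ ^ 2)))
          ∂(Measure.map (Matrix.toEuclideanLin Y) volume) := (lintegral_map hm hYm).symm
    _ = _ := by
        rw [Measure.map_linearMap_addHaar_eq_smul_addHaar _ hY, lintegral_smul_measure,
          lintegral_exp_neg_pi_norm_sq, smul_eq_mul, mul_one, LinearMap.det_toLpLin, hdet,
          ← Real.sqrt_eq_rpow, Real.sqrt_sq (abs_nonneg _), abs_inv]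

theorem posDef_smul {M : Matrix (Fin d) (Fin d) ℝ} (hM : M.PosDef) {t : ℝ} (ht : 0 < t) :
    (t • M).PosDef := hM.smul ht

theorem inner_smul_toEuclideanLin (M : Matrix (Fin d) (Fin d) ℝ) (t : ℝ)
    (x : EuclideanSpace ℝ (Fin d)) :
    inner ℝ x (Matrix.toEuclideanLin (t • M) x) = t * inner ℝ x (Matrix.toEuclideanLin M x) := by
  rw [map_smul, LinearMap.smul_apply, inner_smul_right]

/-- A gaussian is concentrated on balls which are large compared with its width. -/
theorem le_lintegral_closedBall_gaussDensity {M : Matrix (Fin d) (Fin d) ℝ} (hM : M.PosDef)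
    {c r : ℝ} (hr : 0 ≤ r) (hc : 0 ≤ c)
    (h : ∀ x, c * ‖x‖ ^ 2 ≤ inner ℝ x (Matrix.toEuclideanLin M x)) :
    ENNReal.ofReal (1 - Real.sqrt 2 ^ d * Real.exp (-(Real.pi * c * r ^ 2 / 2))) *
        ∫⁻ x, gaussDensity M x ≤ ∫⁻ x in Metric.closedBall 0 r, gaussDensity M x := by
  set e := Real.exp (-(Real.pi * c * r ^ 2 / 2)) with he
  have he0 : 0 ≤ e := (Real.exp_pos _).le
  have hhalf : ∫⁻ x, gaussDensity ((1 / 2 : ℝ) • M) x =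
      ENNReal.ofReal (Real.sqrt 2 ^ d) * ∫⁻ x, gaussDensity M x := by
    rw [lintegral_gaussDensity hM, lintegral_gaussDensity (posDef_smul hM one_half_pos),
      ← ENNReal.ofReal_mul (by positivity), Matrix.det_smul, Fintype.card_fin,
      Real.mul_rpow (by positivity) hM.det_pos.le, mul_inv, ← Real.sqrt_eq_rpow,
      one_div, inv_pow, Real.sqrt_inv, inv_inv]
    congr 2
    rw [Real.sqrt_eq_iff_mul_self_eq (by positivity) (by positivity)]
    rw [← mul_pow, Real.mul_self_sqrt (by norm_num)]
  have htail : ∫⁻ x in (Metric.closedBall 0 r)ᶜ, gaussDensity M x ≤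
      ENNReal.ofReal (Real.sqrt 2 ^ d * e) * ∫⁻ x, gaussDensity M x := by
    rw [mul_comm (Real.sqrt 2 ^ d), ENNReal.ofReal_mul he0, mul_assoc, ← hhalf,
      ← lintegral_const_mul _ (measurable_gaussDensity _)]
    refine (setLIntegral_mono' measurableSet_closedBall.compl fun x hx => ?_).trans
      (setLIntegral_le_lintegral _ _)
    rw [gaussDensity, gaussDensity, ← ENNReal.ofReal_mul he0, he, ← Real.exp_add]
    refine ENNReal.ofReal_le_ofReal (Real.exp_le_exp.2 ?_)
    have hx' : r < ‖x‖ := by simpa using hx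
    have h1 : c * r ^ 2 ≤ c * ‖x‖ ^ 2 := by gcongr
    have h2 := mul_le_mul_of_nonneg_left (h1.trans (h x)) Real.pi_pos.le
    rw [inner_smul_toEuclideanLin]
    linarith
  have hfin : ∫⁻ x, gaussDensity M x ≠ ⊤ := by
    rw [lintegral_gaussDensity hM]; exact ENNReal.ofReal_ne_top
  rw [ENNReal.ofReal_sub _ (by positivity), ENNReal.ofReal_one,
    ENNReal.sub_mul (fun _ _ => hfin), one_mul, tsub_le_iff_right]
  calc ∫⁻ x, gaussDensity M x = _ :=
        (lintegral_add_compl _ (measurableSet_closedBall (x := 0) (ε := r))).symm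
    _ ≤ _ := by gcongr

/-- A gaussian varies slowly at small scales on bounded sets. -/
theorem gaussDensity_le_mul {M : Matrix (Fin d) (Fin d) ℝ} {ε : ℝ}
    {a b : EuclideanSpace ℝ (Fin d)}
    (h : Real.pi * (matOpNorm M * ‖a - b‖ * (‖a‖ + ‖b‖)) ≤ ε) :
    gaussDensity M a ≤ ENNReal.ofReal (Real.exp ε) * gaussDensity M b := by
  rw [gaussDensity, gaussDensity, ← ENNReal.ofReal_mul (Real.exp_pos _).le, ← Real.exp_add]
  refine ENNReal.ofReal_le_ofReal (Real.exp_le_exp.2 ?_)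
  have := mul_le_mul_of_nonneg_left (inner_sub_inner_le M a b) Real.pi_pos.le
  linarith

variable {m n : ℕ} {nj : Fin m → ℕ}

theorem inner_sum_toEuclideanLin (p : Fin m → ℝ) (L : ∀ j, Matrix (Fin (nj j)) (Fin n) ℝ)
    (A : ∀ j, Matrix (Fin (nj j)) (Fin (nj j)) ℝ) (x : EuclideanSpace ℝ (Fin n)) :
    inner ℝ x (Matrix.toEuclideanLin (∑ j, p j • ((L j)ᴴ * A j * L j)) x) =
      ∑ j, p j * inner ℝ (Matrix.toEuclideanLin (L j) x)
        (Matrix.toEuclideanLin (A j) (Matrix.toEuclideanLin (L j) x)) := by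
  rw [map_sum, LinearMap.sum_apply, inner_sum]
  refine Finset.sum_congr rfl fun j _ => ?_
  rw [inner_smul_toEuclideanLin, Matrix.mul_assoc, toEuclideanLin_mul,
    inner_toEuclideanLin_conjTranspose, toEuclideanLin_mul]

theorem prod_gaussDensity_rpow (p : Fin m → ℝ)
    (L : ∀ j, Matrix (Fin (nj j)) (Fin n) ℝ) (A : ∀ j, Matrix (Fin (nj j)) (Fin (nj j)) ℝ)
    (x : EuclideanSpace ℝ (Fin n)) :
    ∏ j, (gaussDensity (A j) (Matrix.toEuclideanLin (L j) x)) ^ p j =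
      gaussDensity (∑ j, p j • ((L j)ᴴ * A j * L j)) x := by
  simp only [gaussDensity]
  rw [inner_sum_toEuclideanLin, Finset.mul_sum, ← Finset.sum_neg_distrib, Real.exp_sum,
    ENNReal.ofReal_prod_of_nonneg fun _ _ => (Real.exp_pos _).le]
  refine Finset.prod_congr rfl fun j _ => ?_
  rw [ENNReal.ofReal_rpow_of_pos (Real.exp_pos _), ← Real.exp_mul]
  congr 2
  ring

theorem posSemidef_sum {p : Fin m → ℝ} (hp : ∀ j, 0 ≤ p j)
    (L : ∀ j, Matrix (Fin (nj j)) (Fin n) ℝ) {A : ∀ j, Matrix (Fin (nj j)) (Fin (nj j)) ℝ}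
    (hA : ∀ j, (A j).PosDef) : (∑ j, p j • ((L j)ᴴ * A j * L j)).PosSemidef :=
  Matrix.posSemidef_sum _ fun j _ =>
    ((hA j).posSemidef.conjTranspose_mul_mul_same (L j)).smul (hp j)

theorem posDef_sum_of_matBLg_pos {p : Fin m → ℝ} (hp : ∀ j, 0 ≤ p j)
    {L : ∀ j, Matrix (Fin (nj j)) (Fin n) ℝ} {A : ∀ j, Matrix (Fin (nj j)) (Fin (nj j)) ℝ}
    (hA : ∀ j, (A j).PosDef) (h : 0 < matBLg nj L p A) :
    (∑ j, p j • ((L j)ᴴ * A j * L j)).PosDef := by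
  rw [(posSemidef_sum hp L hA).posDef_iff_det_ne_zero]
  intro h0
  rw [matBLg, h0, Real.zero_rpow (by norm_num), div_zero] at h
  exact lt_irrefl _ h

theorem lintegral_prod_gaussDensity {p : Fin m → ℝ}
    {L : ∀ j, Matrix (Fin (nj j)) (Fin n) ℝ} {A : ∀ j, Matrix (Fin (nj j)) (Fin (nj j)) ℝ}
    (hA : ∀ j, (A j).PosDef) (hM : (∑ j, p j • ((L j)ᴴ * A j * L j)).PosDef) :
    ∫⁻ x, gaussDensity (∑ j, p j • ((L j)ᴴ * A j * L j)) x =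
      ENNReal.ofReal (matBLg nj L p A) * ∏ j, (∫⁻ x, gaussDensity (A j) x) ^ p j := by
  have hd : ∀ j, 0 < (A j).det := fun j => (hA j).det_pos
  have h1 : ∏ j, (∫⁻ x, gaussDensity (A j) x) ^ p j =
      ENNReal.ofReal (∏ j, (A j).det ^ (p j / 2))⁻¹ := by
    rw [← Finset.prod_inv_distrib, ENNReal.ofReal_prod_of_nonneg fun j _ =>
      inv_nonneg.2 (Real.rpow_nonneg (hd j).le _)]
    refine Finset.prod_congr rfl fun j _ => ?_
    have := Real.rpow_pos_of_pos (hd j) (1 / 2)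
    rw [lintegral_gaussDensity (hA j), ENNReal.ofReal_rpow_of_pos (inv_pos.2 this),
      Real.inv_rpow this.le, ← Real.rpow_mul (hd j).le]
    congr 3
    ring
  have hprod : 0 < ∏ j, (A j).det ^ (p j / 2) :=
    Finset.prod_pos fun j _ => Real.rpow_pos_of_pos (hd j) _
  have hMd := Real.rpow_pos_of_pos hM.det_pos (1 / 2)
  rw [h1, lintegral_gaussDensity hM, matBLg, ← ENNReal.ofReal_mul (div_pos hprod hMd).le,
    div_mul_eq_mul_div, mul_inv_cancel₀ hprod.ne', inv_eq_one_div]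

theorem matBLg_smul {p : Fin m → ℝ}
    {L : ∀ j, Matrix (Fin (nj j)) (Fin n) ℝ} {A : ∀ j, Matrix (Fin (nj j)) (Fin (nj j)) ℝ}
    (hA : ∀ j, (A j).PosDef) (hM : (∑ j, p j • ((L j)ᴴ * A j * L j)).PosDef) {t : ℝ}
    (ht : 0 < t) :
    matBLg nj L p (fun j => t • A j) = t ^ ((∑ j, p j * nj j - n) / 2) * matBLg nj L p A := by
  have hsum : ∑ j, p j • ((L j)ᴴ * (t • A j) * L j) = t • ∑ j, p j • ((L j)ᴴ * A j * L j) := by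
    rw [Finset.smul_sum]
    refine Finset.sum_congr rfl fun j _ => ?_
    rw [Matrix.mul_smul, Matrix.smul_mul, smul_comm]
  have h1 : ∏ j, (t • A j).det ^ (p j / 2) =
      t ^ ((∑ j, p j * nj j) / 2) * ∏ j, (A j).det ^ (p j / 2) := by
    rw [Finset.sum_div, Real.rpow_sum_of_pos ht, ← Finset.prod_mul_distrib]
    refine Finset.prod_congr rfl fun j _ => ?_
    rw [Matrix.det_smul, Fintype.card_fin, Real.mul_rpow (pow_pos ht _).le (hA j).det_pos.le,
      ← Real.rpow_natCast_mul ht.le, mul_div_left_comm, mul_div_assoc', mul_comm (p j)]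
  have h2 : (t • ∑ j, p j • ((L j)ᴴ * A j * L j)).det ^ ((1 : ℝ) / 2) =
      t ^ ((n : ℝ) / 2) * (∑ j, p j • ((L j)ᴴ * A j * L j)).det ^ ((1 : ℝ) / 2) := by
    rw [Matrix.det_smul, Fintype.card_fin, Real.mul_rpow (pow_pos ht _).le hM.det_pos.le,
      ← Real.rpow_natCast_mul ht.le, mul_one_div]
  rw [matBLg, matBLg, hsum, h1, h2, sub_div, Real.rpow_sub ht, div_mul_div_comm]

end Gaussian

section NearExtremisers

variable {m n : ℕ} {nj : Fin m → ℕ}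

theorem BLe_ne_zero {p : Fin m → ℝ} (hp : ∀ j, 0 ≤ p j)
    (L : ∀ j, EuclideanSpace ℝ (Fin n) →L[ℝ] EuclideanSpace ℝ (Fin (nj j))) :
    BLe nj L p ≠ 0 := by
  intro h0
  set f : ∀ j, EuclideanSpace ℝ (Fin (nj j)) → ℝ≥0∞ :=
    fun j => (Metric.closedBall 0 1).indicator fun _ => 1 with hf
  have h := lintegral_prod_rpow_le_BLe hp (L := L) (by rw [h0]; exact ENNReal.zero_ne_top) (f := f)
    (fun j => measurable_const.indicator measurableSet_closedBall) (fun j => by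
      simp only [hf]
      rw [lintegral_indicator measurableSet_closedBall, setLIntegral_one]
      exact measure_closedBall_lt_top.ne)
  rw [h0, zero_mul, nonpos_iff_eq_zero] at h
  have hU : ∀ᶠ x in nhds (0 : EuclideanSpace ℝ (Fin n)), ∀ j, ‖L j x‖ ≤ 1 := by
    refine Filter.eventually_all.2 fun j => ?_
    have : Filter.Tendsto (fun x => ‖L j x‖) (nhds 0) (nhds 0) := by
      simpa using ((L j).continuous.norm).tendsto 0
    exact (this.eventually (ge_mem_nhds zero_lt_one))
  obtain ⟨ε, hε, hball⟩ := Metric.eventually_nhds_iff_ball.1 hU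
  have h1 : ∫⁻ _ in Metric.ball (0 : EuclideanSpace ℝ (Fin n)) ε, 1 ≤ 0 := by
    rw [← h]
    refine (setLIntegral_mono' measurableSet_ball fun x hx => ?_).trans
      (setLIntegral_le_lintegral _ _)
    refine (Finset.prod_eq_one fun j _ => ?_).ge
    simp only [hf]
    rw [Set.indicator_of_mem (mem_closedBall_zero_iff.2 (hball x hx j)), ENNReal.one_rpow]
  rw [setLIntegral_one] at h1
  exact (Metric.measure_ball_pos volume _ hε).not_ge h1

theorem lintegral_gaussDensity_ne {d : ℕ} {M : Matrix (Fin d) (Fin d) ℝ} (hM : M.PosDef) :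
    ∫⁻ x, gaussDensity M x ≠ 0 ∧ ∫⁻ x, gaussDensity M x ≠ ⊤ := by
  rw [lintegral_gaussDensity hM]
  refine ⟨?_, ENNReal.ofReal_ne_top⟩
  rw [Ne, ENNReal.ofReal_eq_zero, not_le]
  exact inv_pos.2 (Real.rpow_pos_of_pos hM.det_pos _)

/-- The Brascamp–Lieb datum of a tuple of matrices. -/
noncomputable def matDatum (L : ∀ j, Matrix (Fin (nj j)) (Fin n) ℝ) (j : Fin m) :
    EuclideanSpace ℝ (Fin n) →L[ℝ] EuclideanSpace ℝ (Fin (nj j)) :=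
  LinearMap.toContinuousLinearMap (Matrix.toEuclideanLin (L j))

theorem matBLg_le_BLe {p : Fin m → ℝ} (hp : ∀ j, 0 ≤ p j)
    {L : ∀ j, Matrix (Fin (nj j)) (Fin n) ℝ} {A : ∀ j, Matrix (Fin (nj j)) (Fin (nj j)) ℝ}
    (hL : BLe nj (matDatum L) p ≠ ⊤)
    (hA : ∀ j, (A j).PosDef) (hM : (∑ j, p j • ((L j)ᴴ * A j * L j)).PosDef) :
    matBLg nj L p A ≤ (BLe nj (matDatum L) p).toReal := by
  rw [← ENNReal.ofReal_le_iff_le_toReal hL]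
  have h := lintegral_prod_rpow_le_BLe hp hL (f := fun j => gaussDensity (A j))
    (fun j => measurable_gaussDensity _) (fun j => (lintegral_gaussDensity_ne (hA j)).2)
  have h2 : ∀ x, ∏ j, (gaussDensity (A j) (matDatum L j x)) ^ p j =
    gaussDensity (∑ j, p j • ((L j)ᴴ * A j * L j)) x := prod_gaussDensity_rpow p L A
  simp_rw [h2] at h
  rw [lintegral_prod_gaussDensity hA hM] at h
  refine (ENNReal.mul_le_mul_iff_left ?_ ?_).1 h
  · refine Finset.prod_ne_zero_iff.2 fun j _ => ?_
    have := lintegral_gaussDensity_ne (hA j)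
    rw [Ne, ENNReal.rpow_eq_zero_iff]
    tauto
  · exact prod_lintegral_rpow_ne_top hp fun j => (lintegral_gaussDensity_ne (hA j)).2

/-- The scaling condition, in the form that the gaussian constant is invariant under dilations. -/
theorem matBLg_smul_eq {p : Fin m → ℝ} (hp : ∀ j, 0 ≤ p j)
    {L : ∀ j, Matrix (Fin (nj j)) (Fin n) ℝ} {A : ∀ j, Matrix (Fin (nj j)) (Fin (nj j)) ℝ}
    (hL : BLe nj (matDatum L) p ≠ ⊤) (hA : ∀ j, (A j).PosDef)
    (hg : 0 < matBLg nj L p A) {t : ℝ} (ht : 0 < t) :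
    matBLg nj L p (fun j => t • A j) = matBLg nj L p A := by
  have hM := posDef_sum_of_matBLg_pos hp hA hg
  set a : ℝ := (∑ j, p j * nj j - n) / 2 with ha
  have key : ∀ s : ℝ, 0 < s → s ^ a * matBLg nj L p A ≤ (BLe nj (matDatum L) p).toReal := by
    intro s hs
    rw [ha, ← matBLg_smul hA hM hs]
    refine matBLg_le_BLe hp hL (fun j => posDef_smul (hA j) hs)
      (posDef_sum_of_matBLg_pos hp (fun j => posDef_smul (hA j) hs) ?_)
    rw [matBLg_smul hA hM hs]
    exact mul_pos (Real.rpow_pos_of_pos hs _) hg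
  have ha0 : a = 0 := by
    by_contra hne
    set C : ℝ := (BLe nj (matDatum L) p).toReal / matBLg nj L p A with hC
    have hC0 : 0 ≤ C := div_nonneg ENNReal.toReal_nonneg hg.le
    have h := key ((C + 1) ^ a⁻¹) (Real.rpow_pos_of_pos (by linarith) _)
    rw [← Real.rpow_mul (by linarith), inv_mul_cancel₀ hne, Real.rpow_one, ← le_div_iff₀ hg] at h
    linarith
  rw [matBLg_smul hA hM ht, ← ha, ha0, Real.rpow_zero, one_mul]

theorem exists_nearly_extremal {p : Fin m → ℝ} (hp : ∀ j, 0 ≤ p j)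
    {L : ∀ j, Matrix (Fin (nj j)) (Fin n) ℝ} {θ K : ℝ} (hθ : θ ∈ Set.Ioo (0 : ℝ) (1 / 2))
    (h : ENNReal.ofReal (1 - θ) * BLe nj (matDatum L) p ≤ ENNReal.ofReal (sSup {x : ℝ |
                ∃ A : ∀ j, Matrix (Fin (nj j)) (Fin (nj j)) ℝ,
                  (∀ j, (A j).PosDef) ∧ (∀ j, matOpNorm (A j) < K) ∧
                  (∀ j, matOpNorm ((A j)⁻¹) < K) ∧ x = matBLg nj L p A})) :
    BLe nj (matDatum L) p ≠ ⊤ ∧ ∃ A : ∀ j, Matrix (Fin (nj j)) (Fin (nj j)) ℝ,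
      (∀ j, (A j).PosDef) ∧ (∀ j, matOpNorm (A j) < K) ∧ (∀ j, matOpNorm ((A j)⁻¹) < K) ∧
      0 < matBLg nj L p A ∧
      ENNReal.ofReal (1 - 2 * θ) * BLe nj (matDatum L) p ≤ ENNReal.ofReal (matBLg nj L p A) := by
  obtain ⟨hθ0, hθ1⟩ := hθ
  have hfin : BLe nj (matDatum L) p ≠ ⊤ := by
    intro htop
    rw [htop, ENNReal.mul_top (by rw [Ne, ENNReal.ofReal_eq_zero]; linarith), top_le_iff] at h
    exact ENNReal.ofReal_ne_top h
  refine ⟨hfin, ?_⟩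
  set b := (BLe nj (matDatum L) p).toReal with hb
  have hb0 : 0 < b := ENNReal.toReal_pos (BLe_ne_zero hp _) hfin
  rw [← ENNReal.ofReal_toReal hfin, ← hb, ← ENNReal.ofReal_mul (by linarith)] at h
  have hlt : (1 - 2 * θ) * b < (1 - θ) * b := by gcongr; linarith
  have hpos : 0 < (1 - θ) * b := mul_pos (by linarith) hb0
  set Z := {x : ℝ | ∃ A : ∀ j, Matrix (Fin (nj j)) (Fin (nj j)) ℝ,
                  (∀ j, (A j).PosDef) ∧ (∀ j, matOpNorm (A j) < K) ∧
                  (∀ j, matOpNorm ((A j)⁻¹) < K) ∧ x = matBLg nj L p A}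
  have hle : (1 - θ) * b ≤ sSup Z := by
    rcases ENNReal.ofReal_le_ofReal_iff'.1 h with h | h
    · exact h
    · linarith
  have hne : Z.Nonempty := by
    by_contra hne
    rw [Set.not_nonempty_iff_eq_empty.1 hne, Real.sSup_empty] at hle
    linarith
  obtain ⟨x, ⟨A, hA, hA1, hA2, rfl⟩, hx⟩ := exists_lt_of_lt_csSup hne (hlt.trans_le hle)
  refine ⟨A, hA, hA1, hA2, ?_, ?_⟩
  · exact lt_of_le_of_lt (mul_nonneg (by linarith) hb0.le) hx
  · rw [← ENNReal.ofReal_toReal hfin, ← ENNReal.ofReal_mul (by linarith)]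
    exact ENNReal.ofReal_le_ofReal hx.le

/-- For nearly extremal gaussians the linear Brascamp–Lieb inequality stays nearly sharp when
localised to a ball which is large compared with the width of the gaussians. -/
theorem mul_BLe_le_lintegral_closedBall {p : Fin m → ℝ} (hp : ∀ j, 0 ≤ p j)
    {L : ∀ j, Matrix (Fin (nj j)) (Fin n) ℝ} {A : ∀ j, Matrix (Fin (nj j)) (Fin (nj j)) ℝ}
    (hL : BLe nj (matDatum L) p ≠ ⊤) (hA : ∀ j, (A j).PosDef)
    {K c₀ t r : ℝ} {c : ℝ≥0∞} (hK : 0 < K) (hAK : ∀ j, matOpNorm ((A j)⁻¹) < K) (hc₀ : 0 ≤ c₀)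
    (hLc : ∀ x, c₀ * ‖x‖ ^ 2 ≤ ∑ j, p j * ‖matDatum L j x‖ ^ 2)
    (hg : 0 < matBLg nj L p A)
    (hc : c * BLe nj (matDatum L) p ≤ ENNReal.ofReal (matBLg nj L p A))
    (ht : 0 < t) (hr : 0 ≤ r) :
    ENNReal.ofReal (1 - Real.sqrt 2 ^ n * Real.exp (-(Real.pi * (t * (c₀ / K)) * r ^ 2 / 2))) * c *
        (BLe nj (matDatum L) p * ∏ j, (∫⁻ x, gaussDensity (t • A j) x) ^ p j) ≤
      ∫⁻ x in Metric.closedBall 0 r, ∏ j, (gaussDensity (t • A j) (matDatum L j x)) ^ p j := by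
  have hAt : ∀ j, (t • A j).PosDef := fun j => posDef_smul (hA j) ht
  have hgt := matBLg_smul_eq hp hL hA hg ht
  have hM := posDef_sum_of_matBLg_pos hp hAt (hgt ▸ hg)
  have h2 : ∀ x, ∏ j, (gaussDensity (t • A j) (matDatum L j x)) ^ p j =
    gaussDensity (∑ j, p j • ((L j)ᴴ * (t • A j) * L j)) x := prod_gaussDensity_rpow p L _
  simp_rw [h2]
  refine le_trans ?_ (le_lintegral_closedBall_gaussDensity hM hr
    (mul_nonneg ht.le (div_nonneg hc₀ hK.le)) ?_)
  · rw [lintegral_prod_gaussDensity hAt hM, hgt, mul_assoc, ← mul_assoc c]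
    gcongr
  · intro x
    rw [inner_sum_toEuclideanLin]
    have h3 : t * (c₀ / K) * ‖x‖ ^ 2 = t / K * (c₀ * ‖x‖ ^ 2) := by ring
    rw [h3]
    refine (mul_le_mul_of_nonneg_left (hLc x) (by positivity)).trans ?_
    rw [Finset.mul_sum]
    refine Finset.sum_le_sum fun j _ => ?_
    rw [inner_smul_toEuclideanLin, mul_left_comm]
    refine mul_le_mul_of_nonneg_left ?_ (hp j)
    rw [div_mul_eq_mul_div, div_le_iff₀ hK, mul_assoc]
    refine mul_le_mul_of_nonneg_left ?_ ht.le
    rw [mul_comm _ K]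
    exact norm_sq_le_mul_inner (hA j) hK (hAK j).le _

theorem exists_lower_bound {p : Fin m → ℝ} (hp : ∀ j, 0 ≤ p j)
    {L : ∀ j, Matrix (Fin (nj j)) (Fin n) ℝ} {A : ∀ j, Matrix (Fin (nj j)) (Fin (nj j)) ℝ}
    (hA : ∀ j, (A j).PosDef) (hg : 0 < matBLg nj L p A) {K : ℝ} (hK : 0 < K)
    (hAK : ∀ j, matOpNorm (A j) < K) :
    ∃ c₀ > (0 : ℝ), ∀ x, c₀ * ‖x‖ ^ 2 ≤ ∑ j, p j * ‖matDatum L j x‖ ^ 2 := by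
  have hM := posDef_sum_of_matBLg_pos hp hA hg
  set M := ∑ j, p j • ((L j)ᴴ * A j * L j) with hMdef
  have hK' : 0 < matOpNorm M⁻¹ + 1 := by linarith [matOpNorm_nonneg M⁻¹]
  refine ⟨((matOpNorm M⁻¹ + 1) * K)⁻¹, by positivity, fun x => ?_⟩
  rw [inv_mul_le_iff₀ (by positivity), mul_assoc]
  refine (norm_sq_le_mul_inner hM hK' (by linarith) x).trans ?_
  refine mul_le_mul_of_nonneg_left ?_ hK'.le
  rw [hMdef, inner_sum_toEuclideanLin, Finset.mul_sum]
  refine Finset.sum_le_sum fun j _ => ?_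
  rw [mul_left_comm]
  refine mul_le_mul_of_nonneg_left ?_ (hp j)
  set y := Matrix.toEuclideanLin (L j) x with hy
  have hy' : matDatum L j x = y := rfl
  rw [hy']
  refine (real_inner_le_norm _ _).trans ?_
  have h1 := norm_toEuclideanLin_le (A j) y
  have h2 := mul_le_mul_of_nonneg_right (hAK j).le (norm_nonneg y)
  nlinarith [norm_nonneg y]

theorem lower_bound_of_near {p : Fin m → ℝ} (hp : ∀ j, p j ∈ Set.Icc (0 : ℝ) 1)
    {L L' : ∀ j, EuclideanSpace ℝ (Fin n) →L[ℝ] EuclideanSpace ℝ (Fin (nj j))} {c₀ e : ℝ}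
    (h : ∀ x, c₀ * ‖x‖ ^ 2 ≤ ∑ j, p j * ‖L j x‖ ^ 2) (hLL : ∀ j, ‖L' j - L j‖ ≤ e)
    (he : 4 * (m * e ^ 2) ≤ c₀) (x : EuclideanSpace ℝ (Fin n)) :
    c₀ / 4 * ‖x‖ ^ 2 ≤ ∑ j, p j * ‖L' j x‖ ^ 2 := by
  have h1 : ∀ j, p j * ‖L j x‖ ^ 2 ≤ 2 * (p j * ‖L' j x‖ ^ 2) + 2 * (e ^ 2 * ‖x‖ ^ 2) := by
    intro j
    have h2 : ‖L j x‖ ≤ ‖L' j x‖ + e * ‖x‖ := by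
      have h3 : ‖(L' j - L j) x‖ ≤ e * ‖x‖ := (L' j - L j).le_of_opNorm_le (hLL j) x
      have h4 : L j x = L' j x - (L' j - L j) x := by simp
      rw [h4]
      exact (norm_sub_le _ _).trans (by linarith)
    have h5 : ‖L j x‖ ^ 2 ≤ 2 * ‖L' j x‖ ^ 2 + 2 * (e ^ 2 * ‖x‖ ^ 2) := by
      have h6 := pow_le_pow_left₀ (norm_nonneg _) h2 2
      nlinarith [sq_nonneg (‖L' j x‖ - e * ‖x‖)]
    have h7 := mul_le_mul_of_nonneg_left h5 (hp j).1
    have h8 : p j * (2 * (e ^ 2 * ‖x‖ ^ 2)) ≤ 1 * (2 * (e ^ 2 * ‖x‖ ^ 2)) :=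
      mul_le_mul_of_nonneg_right (hp j).2 (by positivity)
    linarith
  have h2 := (h x).trans (Finset.sum_le_sum fun j _ => h1 j)
  rw [Finset.sum_add_distrib, ← Finset.mul_sum, Finset.sum_const, Finset.card_univ,
    Fintype.card_fin, nsmul_eq_mul] at h2
  have h3 := mul_le_mul_of_nonneg_right he (sq_nonneg ‖x‖)
  linarith

end NearExtremisers

section Geometry

theorem exists_uniform_bounds {m n : ℕ} {nj : Fin m → ℕ}
    {B : ∀ j, EuclideanSpace ℝ (Fin n) → EuclideanSpace ℝ (Fin (nj j))}
    (hB : ∀ j, ∃ V ∈ nhds (0 : EuclideanSpace ℝ (Fin n)), IsOpen V ∧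
      ContDiffOn ℝ 2 (B j) V ∧ ∀ x ∈ V, Function.Surjective (fderiv ℝ (B j) x)) :
    ∃ R > (0 : ℝ), ∃ K ≥ (1 : ℝ), ∀ j, ∀ x ∈ Metric.ball (0 : EuclideanSpace ℝ (Fin n)) R,
      DifferentiableAt ℝ (B j) x ∧ Function.Surjective (fderiv ℝ (B j) x) ∧
      ‖fderiv ℝ (B j) x‖ ≤ K ∧ ∀ y ∈ Metric.ball (0 : EuclideanSpace ℝ (Fin n)) R,
        ‖B j x - B j y‖ ≤ K * ‖x - y‖ ∧
        ‖fderiv ℝ (B j) x - fderiv ℝ (B j) y‖ ≤ K * ‖x - y‖ := by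
  have h : ∀ j, ∃ K : ℝ, 0 ≤ K ∧ ∃ t ∈ nhds (0 : EuclideanSpace ℝ (Fin n)), ∀ x ∈ t,
      DifferentiableAt ℝ (B j) x ∧ Function.Surjective (fderiv ℝ (B j) x) ∧
      ∀ y ∈ t, ‖B j x - B j y‖ ≤ K * ‖x - y‖ ∧
        ‖fderiv ℝ (B j) x - fderiv ℝ (B j) y‖ ≤ K * ‖x - y‖ := by
    intro j
    obtain ⟨V, hV, hVo, hVc, hVs⟩ := hB j
    have hc : ∀ x ∈ V, ContDiffAt ℝ 2 (B j) x := fun x hx => hVc.contDiffAt (hVo.mem_nhds hx)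
    have h0 := hc 0 (mem_of_mem_nhds hV)
    obtain ⟨K₁, t₁, ht₁, hl₁⟩ := (h0.of_le (by norm_num)).exists_lipschitzOnWith
    obtain ⟨K₂, t₂, ht₂, hl₂⟩ :=
      (h0.fderiv_right (m := 1) (by norm_num)).exists_lipschitzOnWith
    refine ⟨K₁ + K₂, by positivity, V ∩ (t₁ ∩ t₂),
      Filter.inter_mem hV (Filter.inter_mem ht₁ ht₂), ?_⟩
    rintro x ⟨hxV, hx₁, hx₂⟩
    refine ⟨(hc x hxV).differentiableAt (by norm_num), hVs x hxV, ?_⟩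
    rintro y ⟨hyV, hy₁, hy₂⟩
    constructor
    · refine (hl₁.norm_sub_le hx₁ hy₁).trans ?_
      gcongr
      simp
    · refine (hl₂.norm_sub_le hx₂ hy₂).trans ?_
      gcongr
      simp
  choose K hK0 t ht hKt using h
  obtain ⟨R, hR, hball⟩ := Metric.mem_nhds_iff.1 (Filter.iInter_mem.2 ht)
  have hKle : ∀ j, K j ≤ 1 + ∑ i, K i := fun j =>
    (Finset.single_le_sum (fun i _ => hK0 i) (Finset.mem_univ j)).trans (by linarith)
  refine ⟨R, hR, 1 + ∑ j, K j, ?_, ?_⟩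
  · have := Finset.sum_nonneg fun i (_ : i ∈ Finset.univ) => hK0 i
    linarith
  intro j x hx
  have hmem : ∀ y ∈ Metric.ball (0 : EuclideanSpace ℝ (Fin n)) R, y ∈ t j :=
    fun y hy => Set.mem_iInter.1 (hball hy) j
  obtain ⟨h1, h2, h3⟩ := hKt j x (hmem x hx)
  refine ⟨h1, h2, ?_, fun y hy => ?_⟩
  · have hl : LipschitzOnWith ⟨K j, hK0 j⟩ (B j) (Metric.ball 0 R) :=
      LipschitzOnWith.of_dist_le_mul fun y hy z hz => by
        rw [dist_eq_norm, dist_eq_norm]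
        exact ((hKt j y (hmem y hy)).2.2 z (hmem z hz)).1
    exact (norm_fderiv_le_of_lipschitzOn ℝ (Metric.isOpen_ball.mem_nhds hx) hl).trans (hKle j)
  · obtain ⟨h4, h5⟩ := h3 y (hmem y hy)
    exact ⟨h4.trans (mul_le_mul_of_nonneg_right (hKle j) (norm_nonneg _)),
      h5.trans (mul_le_mul_of_nonneg_right (hKle j) (norm_nonneg _))⟩

end Geometry

section Asymptotics

open Filter Topology

theorem eventually_mul_rpow_le {C c x y : ℝ} (hc : 0 < c) (hxy : y < x) :
    ∀ᶠ δ in 𝓝[>] (0 : ℝ), C * δ ^ x ≤ c * δ ^ y := by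
  have h : Tendsto (fun δ : ℝ => C * δ ^ (x - y)) (𝓝[>] 0) (𝓝 0) := by
    have h1 : ContinuousAt (fun δ : ℝ => δ ^ (x - y)) 0 :=
      Real.continuousAt_rpow_const _ _ (Or.inr (by linarith))
    have h2 := (h1.tendsto.mono_left (nhdsWithin_le_nhds (s := Set.Ioi 0))).const_mul C
    rwa [Real.zero_rpow (by linarith), mul_zero] at h2
  filter_upwards [h.eventually (ge_mem_nhds hc), self_mem_nhdsWithin] with δ hδ hδ0
  have hδ0' : (0 : ℝ) < δ := hδ0
  have : δ ^ x = δ ^ (x - y) * δ ^ y := by rw [← Real.rpow_add hδ0']; ring_nf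
  rw [this, ← mul_assoc]
  exact mul_le_mul_of_nonneg_right hδ (Real.rpow_nonneg hδ0'.le _)

theorem eventually_mul_exp_neg_rpow_le {C c k s y : ℝ} (hc : 0 < c) (hk : 0 < k) (hs : 0 < s) :
    ∀ᶠ δ in 𝓝[>] (0 : ℝ), C * Real.exp (-(k * δ ^ (-s))) ≤ c * δ ^ y := by
  have h1 : Tendsto (fun δ : ℝ => δ ^ (-s)) (𝓝[>] 0) atTop := tendsto_rpow_neg_nhdsGT_zero (by linarith)
  have h2 := ((tendsto_rpow_mul_exp_neg_mul_atTop_nhds_zero (y / s) k hk).comp h1).const_mul C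
  rw [mul_zero] at h2
  filter_upwards [h2.eventually (ge_mem_nhds hc), self_mem_nhdsWithin] with δ hδ hδ0
  have hδ0' : (0 : ℝ) < δ := hδ0
  have hy := Real.rpow_pos_of_pos hδ0' y
  simp only [Function.comp_apply] at hδ
  rw [← Real.rpow_mul hδ0'.le, neg_mul, mul_div_cancel₀ _ hs.ne', Real.rpow_neg hδ0'.le,
    neg_mul] at hδ
  have := mul_le_mul_of_nonneg_right hδ hy.le
  calc _ = C * ((δ ^ y)⁻¹ * Real.exp (-(k * δ ^ (-s)))) * δ ^ y := by field_simp
    _ ≤ _ := this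

end Asymptotics

section SingleScale

variable {m n : ℕ} {nj : Fin m → ℕ}

theorem matOpNorm_smul {a b : ℕ} (t : ℝ) (A : Matrix (Fin a) (Fin b) ℝ) :
    matOpNorm (t • A) = |t| * matOpNorm A := by
  rw [matOpNorm, matOpNorm, map_smul, map_smul, norm_smul, Real.norm_eq_abs]

theorem toContinuousLinearMap_toEuclideanLin_toMatrix {a b : ℕ}
    (T : EuclideanSpace ℝ (Fin a) →L[ℝ] EuclideanSpace ℝ (Fin b)) :
    LinearMap.toContinuousLinearMap (Matrix.toEuclideanLin
      (LinearMap.toMatrix (EuclideanSpace.basisFun (Fin a) ℝ).toBasis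
        (EuclideanSpace.basisFun (Fin b) ℝ).toBasis
        (T : EuclideanSpace ℝ (Fin a) →ₗ[ℝ] EuclideanSpace ℝ (Fin b)))) = T := by
  rw [Matrix.toEuclideanLin_eq_toLin_orthonormal, Matrix.toLin_toMatrix]
  ext
  rfl

theorem one_le_one_add_mul_exp_neg_mul {s : ℝ} (hs0 : 0 ≤ s) (hs1 : s ≤ 1) :
    1 ≤ (1 + s) * (Real.exp (-(s / 8)) * (1 - s / 8)) := by
  have h := Real.add_one_le_exp (-(s / 8))
  have h2 : (1 - s / 8) * (1 - s / 8) ≤ Real.exp (-(s / 8)) * (1 - s / 8) :=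
    mul_le_mul_of_nonneg_right (by linarith) (by linarith)
  have h3 : 1 ≤ (1 + s) * ((1 - s / 8) * (1 - s / 8)) := by
    nlinarith [mul_nonneg hs0 (sub_nonneg.2 hs1), mul_nonneg (mul_nonneg hs0 hs0) hs0]
  exact h3.trans (mul_le_mul_of_nonneg_left h2 (by linarith))

theorem le_one_add_mul_of_mul_le {s a b e : ℝ} (hs0 : 0 ≤ s) (hs1 : s ≤ 1) (ha : a ≤ s / 16)
    (hb0 : 0 ≤ b) (hb : b ≤ s / 16) (he : e ≤ s / 8) {I J : ℝ≥0∞}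
    (h : ENNReal.ofReal (1 - a) * ENNReal.ofReal (1 - b) * I ≤ ENNReal.ofReal (Real.exp e) * J) :
    I ≤ ENNReal.ofReal (1 + s) * J := by
  have h1 : ENNReal.ofReal (1 - s / 8) * I ≤ ENNReal.ofReal (Real.exp (s / 8)) * J := by
    calc ENNReal.ofReal (1 - s / 8) * I
        ≤ ENNReal.ofReal (1 - a) * ENNReal.ofReal (1 - b) * I := by
          rw [← ENNReal.ofReal_mul (by linarith)]
          gcongr
          nlinarith
      _ ≤ _ := h
      _ ≤ _ := by gcongr
  calc I ≤ ENNReal.ofReal ((1 + s) * (Real.exp (-(s / 8)) * (1 - s / 8))) * I :=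
        le_mul_of_one_le_left' (by
          rw [← ENNReal.ofReal_one]
          exact ENNReal.ofReal_le_ofReal (one_le_one_add_mul_exp_neg_mul hs0 hs1))
    _ = ENNReal.ofReal (1 + s) * (ENNReal.ofReal (Real.exp (-(s / 8))) *
        (ENNReal.ofReal (1 - s / 8) * I)) := by
          rw [ENNReal.ofReal_mul (by linarith), ENNReal.ofReal_mul (Real.exp_pos _).le, mul_assoc,
            mul_assoc]
    _ ≤ ENNReal.ofReal (1 + s) * (ENNReal.ofReal (Real.exp (-(s / 8))) *
        (ENNReal.ofReal (Real.exp (s / 8)) * J)) := by gcongr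
    _ = ENNReal.ofReal (1 + s) * J := by
          rw [← mul_assoc (ENNReal.ofReal (Real.exp (-(s / 8)))),
            ← ENNReal.ofReal_mul (Real.exp_pos _).le, ← Real.exp_add, neg_add_cancel, Real.exp_zero,
            ENNReal.ofReal_one, one_mul]

theorem locC_le_of_nearly_extremal {p : Fin m → ℝ} (hp : ∀ j, p j ∈ Set.Icc (0 : ℝ) 1)
    {B : ∀ j, EuclideanSpace ℝ (Fin n) → EuclideanSpace ℝ (Fin (nj j))}
    {L : ∀ j, Matrix (Fin (nj j)) (Fin n) ℝ} {A : ∀ j, Matrix (Fin (nj j)) (Fin (nj j)) ℝ}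
    {u : EuclideanSpace ℝ (Fin n)} {δ r d ρ μ κ ε s t θ c₀ K M : ℝ}
    (hLu : ∀ j, matDatum L j = fderiv ℝ (B j) u) (hK : 0 ≤ K)
    (hB : ∀ j, ∀ x ∈ Metric.closedBall u (2 * δ), DifferentiableAt ℝ (B j) x ∧
      ‖fderiv ℝ (B j) x - fderiv ℝ (B j) u‖ ≤ K * ‖x - u‖ ∧
      ∀ y ∈ Metric.closedBall u (2 * δ), ‖B j x - B j y‖ ≤ K * ‖x - y‖)
    (hKu : ∀ j, ‖fderiv ℝ (B j) u‖ ≤ K)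
    (hL : BLe nj (matDatum L) p ≠ ⊤) (hA : ∀ j, (A j).PosDef) (hM : 0 < M)
    (hAM : ∀ j, matOpNorm (A j) < M) (hAM' : ∀ j, matOpNorm ((A j)⁻¹) < M)
    (hg : 0 < matBLg nj L p A)
    (hθ : ENNReal.ofReal (1 - 2 * θ) * BLe nj (matDatum L) p ≤ ENNReal.ofReal (matBLg nj L p A))
    (hc₀ : 0 ≤ c₀) (hLc : ∀ x, c₀ * ‖x‖ ^ 2 ≤ ∑ j, p j * ‖matDatum L j x‖ ^ 2)
    (hr : 0 < r) (hrδ : 3 * r ≤ δ) (hμ : 0 < μ) (hμd : μ ≤ d) (hκ : 0 ≤ κ)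
    (hd₁ : 4 * K * δ ^ 2 ≤ d) (hd₂ : 2 * K * δ * r ≤ d) (hdρ : d ≤ ρ) (hρ : 2 * K * r + μ ≤ ρ)
    (ht : 0 < t) (hε : Real.pi * (t * M * d * (3 * ρ)) ≤ ε) (hs0 : 0 ≤ s) (hs1 : s ≤ 1)
    (hεs : ε ≤ s) (hms : 2 * m * ε ≤ s / 8) (hθ0 : 0 ≤ θ) (hθs : 2 * θ ≤ s / 16)
    (htail : Real.sqrt 2 ^ n * Real.exp (-(Real.pi * (t * (c₀ / M)) * r ^ 2 / 2)) ≤ s / 16) :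
    locC nj B p u δ μ κ ≤ ENNReal.ofReal (1 + s) *
      ⨆ x ∈ Metric.closedBall u (2 * δ), locC nj B p x r μ (κ * Real.exp s) := by
  have hp0 : ∀ j, 0 ≤ p j := fun j => (hp j).1
  have hd0 : 0 < d := hμ.trans_le hμd
  have hρ0 : 0 < ρ := hd0.trans_le hdρ
  have hε0 : 0 ≤ ε := le_trans (by positivity) hε
  have hlin : ∀ j, ∀ x ∈ Metric.closedBall u (2 * δ), ∀ y ∈ Metric.closedBall u (2 * δ),
      ‖B j x - B j y - matDatum L j (x - y)‖ ≤ K * (2 * δ) * ‖x - y‖ := by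
    intro j x hx y hy
    rw [hLu]
    refine (convex_closedBall u (2 * δ)).norm_image_sub_le_of_norm_fderiv_le' (𝕜 := ℝ)
      (fun z hz => (hB j z hz).1) (fun z hz => ?_) hy hx
    refine (hB j z hz).2.1.trans (mul_le_mul_of_nonneg_left ?_ hK)
    rwa [← dist_eq_norm, ← Metric.mem_closedBall]
  have hsub : ∀ {a : ℝ} {z y : EuclideanSpace ℝ (Fin n)}, z ∈ Metric.closedBall u (δ + r) →
      y ∈ Metric.closedBall z a → a ≤ 2 * r → y ∈ Metric.closedBall u (2 * δ) := by
    intro a z y hz hy ha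
    rw [Metric.mem_closedBall] at *
    linarith [dist_triangle y z u]
  have hz2 : ∀ z ∈ Metric.closedBall u (δ + r), z ∈ Metric.closedBall u (2 * δ) :=
    fun z hz => Metric.closedBall_subset_closedBall (by linarith) hz
  have hu2 : u ∈ Metric.closedBall u (2 * δ) := Metric.mem_closedBall_self (by linarith)
  refine sInf_le fun f hfm hft hfκ => ?_
  rw [mul_assoc]
  refine le_one_add_mul_of_mul_le hs0 hs1 htail (by linarith) hθs hms ?_
  rw [← mul_assoc (ENNReal.ofReal (Real.exp _))]
  refine lintegral_prod_rpow_le_of_kernel (g := fun j => gaussDensity (t • A j)) hp hL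
    (BLe_ne_zero hp0 _) hr hrδ hμ hμd hdρ hε0 hεs hκ ?_ ?_ ?_ ?_ ?_
    (fun j => measurable_gaussDensity _)
    (fun j => (lintegral_gaussDensity_ne (posDef_smul (hA j) ht)).1)
    (fun j => (lintegral_gaussDensity_ne (posDef_smul (hA j) ht)).2)
    (fun j => gaussDensity_le_one (posDef_smul (hA j) ht)) ?_
    (mul_BLe_le_lintegral_closedBall hp0 hL hA hM hAM' hc₀ hLc hg hθ ht hr.le)
    (fun z hz => le_iSup₂ (f := fun z (_ : z ∈ Metric.closedBall u (2 * δ)) =>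
      locC nj B p z r μ (κ * Real.exp s)) z hz) hfm hft hfκ
  · intro j x hx
    exact (hB j x (Metric.closedBall_subset_closedBall (by linarith) hx)).1.continuousAt
      |>.continuousWithinAt
  · intro j z hz y hy
    have h := (hB j z (hz2 z hz)).2.2 y (hsub hz hy le_rfl)
    rw [Metric.mem_closedBall', dist_eq_norm] at hy
    have := mul_le_mul_of_nonneg_left hy hK
    linarith
  · intro j z hz y hy
    refine (hlin j z (hz2 z hz) y (hsub hz hy (by linarith))).trans (le_trans ?_ hd₂)
    rw [Metric.mem_closedBall', dist_eq_norm] at hy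
    have := mul_le_mul_of_nonneg_left hy (by nlinarith : 0 ≤ K * (2 * δ))
    linarith
  · intro j z hz
    refine (hlin j z (hz2 z hz) u hu2).trans (le_trans ?_ hd₁)
    have hz' := hz2 z hz
    rw [Metric.mem_closedBall, dist_eq_norm] at hz'
    have := mul_le_mul_of_nonneg_left hz' (by nlinarith : 0 ≤ K * (2 * δ))
    linarith
  · intro j x hx
    rw [mem_closedBall_zero_iff] at hx
    rw [hLu]
    have h := (fderiv ℝ (B j) u).le_of_opNorm_le (hKu j) x
    have := mul_le_mul_of_nonneg_left hx hK
    nlinarith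
  · intro j a b ha hb hab
    refine gaussDensity_le_mul (le_trans ?_ hε)
    rw [matOpNorm_smul, abs_of_pos ht]
    have h0 := matOpNorm_nonneg (A j)
    gcongr
    · exact (hAM j).le
    · linarith

end SingleScale

/-- **Proposition (recursive inequality of the induction on scales).**
Let `B_j : ℝ^n → ℝ^{n_j}` be `C²` submersions near `0` with `BL(dB(0),p) < ∞`, and fix
`α ∈ (1,2)`, `β ∈ (0,2−α)`, `γ ∈ (0, min{(2−α−β)/((n+2)α), β/(2α)})`, an exponent
`N ∈ ℕ` with the effective-Lieb property at the datum `(dB(0),p)`, `τ ∈ (0, γ/N)` and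
`σ ∈ (0, min{β − 2αγ, ατ})`.  Then there is `ν > 0` such that whenever `u ∈ U_ν(0)`,
`κ > 1`, `δ ∈ (0,ν)` and `μ > 0` satisfy `δ^{α+β} > μ`,
`𝓒(u,δ,μ,κ) ≤ (1 + δ^σ) · max_{x ∈ U_{2δ}(u)} 𝓒(x, δ^α, μ, κ e^{δ^σ})`. -/
theorem recursive_inequality
    {m n : ℕ} (nj : Fin m → ℕ)
    (B : ∀ j, EuclideanSpace ℝ (Fin n) → EuclideanSpace ℝ (Fin (nj j)))
    (p : Fin m → ℝ) (hp : ∀ j, p j ∈ Set.Icc (0 : ℝ) 1)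
    (hB : ∀ j, ∃ V ∈ nhds (0 : EuclideanSpace ℝ (Fin n)), IsOpen V ∧
      ContDiffOn ℝ 2 (B j) V ∧ ∀ x ∈ V, Function.Surjective (fderiv ℝ (B j) x))
    (hfin : BLe nj (fun j => fderiv ℝ (B j) 0) p ≠ ⊤)
    (α β γ : ℝ) (hα : α ∈ Set.Ioo (1 : ℝ) 2) (hβ : β ∈ Set.Ioo (0 : ℝ) (2 - α))
    (hγ : γ ∈ Set.Ioo (0 : ℝ)
      (min ((2 - α - β) / (((n : ℝ) + 2) * α)) (β / (2 * α))))
    (N : ℕ)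
    (hN : ∃ δ₀ > (0 : ℝ), ∃ η > (0 : ℝ),
      ∀ L : ∀ j, Matrix (Fin (nj j)) (Fin n) ℝ,
        (∀ j, Function.Surjective (Matrix.toEuclideanLin (L j))) →
        (∀ j, matOpNorm (L j
            - LinearMap.toMatrix (EuclideanSpace.basisFun (Fin n) ℝ).toBasis
                (EuclideanSpace.basisFun (Fin (nj j)) ℝ).toBasis
                (fderiv ℝ (B j) 0 :
                  EuclideanSpace ℝ (Fin n) →ₗ[ℝ] EuclideanSpace ℝ (Fin (nj j)))) < η) →
        ∀ δ ∈ Set.Ioo (0 : ℝ) δ₀,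
          ENNReal.ofReal (1 - δ)
              * BLe nj (fun j =>
                  LinearMap.toContinuousLinearMap (Matrix.toEuclideanLin (L j))) p
            ≤ ENNReal.ofReal (sSup {x : ℝ |
                ∃ A : ∀ j, Matrix (Fin (nj j)) (Fin (nj j)) ℝ,
                  (∀ j, (A j).PosDef) ∧
                  (∀ j, matOpNorm (A j) < δ ^ (-(N : ℝ))) ∧
                  (∀ j, matOpNorm ((A j)⁻¹) < δ ^ (-(N : ℝ))) ∧
                  x = matBLg nj L p A}))
    (τ σ : ℝ) (hτ : τ ∈ Set.Ioo (0 : ℝ) (γ / N))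
    (hσ : σ ∈ Set.Ioo (0 : ℝ) (min (β - 2 * α * γ) (α * τ))) :
    ∃ ν > (0 : ℝ), ∀ u ∈ Metric.closedBall (0 : EuclideanSpace ℝ (Fin n)) ν,
      ∀ κ > (1 : ℝ), ∀ δ ∈ Set.Ioo (0 : ℝ) ν, ∀ μ > (0 : ℝ), μ < δ ^ (α + β) →
        locC nj B p u δ μ κ
          ≤ ENNReal.ofReal (1 + δ ^ σ) *
              ⨆ x ∈ Metric.closedBall u (2 * δ),
                locC nj B p x (δ ^ α) μ (κ * Real.exp (δ ^ σ)) := by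
  obtain ⟨δ₀, hδ₀, η, hη, hN⟩ := hN
  obtain ⟨R, hR, K, hK, hRK⟩ := exists_uniform_bounds hB
  obtain ⟨hα1, hα2⟩ := hα
  obtain ⟨hβ0, hβ2⟩ := hβ
  obtain ⟨hγ0, hγ1⟩ := hγ
  obtain ⟨hτ0, hτ1⟩ := hτ
  obtain ⟨hσ0, hσ1⟩ := hσ
  obtain ⟨hσβ, hστ⟩ := lt_min_iff.1 hσ1
  have hp0 : ∀ j, 0 ≤ p j := fun j => (hp j).1
  have hK0 : 0 < K := by linarith
  have hN0 : (0 : ℝ) < N := by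
    rcases (Nat.cast_nonneg N : (0 : ℝ) ≤ N).eq_or_lt with h | h
    · rw [← h, div_zero] at hτ1
      linarith
    · exact h
  have hτN : τ * N < γ := (lt_div_iff₀ hN0).1 hτ1
  have hατ : 0 < α * τ := by nlinarith
  have hgap : 0 < 2 * α * (γ - τ * N) := by
    have : 0 < γ - τ * N := by linarith
    positivity
  -- the linear data
  set L : EuclideanSpace ℝ (Fin n) → ∀ j, Matrix (Fin (nj j)) (Fin n) ℝ := fun u j =>
    LinearMap.toMatrix (EuclideanSpace.basisFun (Fin n) ℝ).toBasis
      (EuclideanSpace.basisFun (Fin (nj j)) ℝ).toBasis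
      (fderiv ℝ (B j) u : EuclideanSpace ℝ (Fin n) →ₗ[ℝ] EuclideanSpace ℝ (Fin (nj j))) with hLdef
  have hLu : ∀ u j, matDatum (L u) j = fderiv ℝ (B j) u := fun u j =>
    toContinuousLinearMap_toEuclideanLin_toMatrix _
  have hLs : ∀ u ∈ Metric.ball (0 : EuclideanSpace ℝ (Fin n)) R, ∀ j,
      Function.Surjective (Matrix.toEuclideanLin (L u j)) := by
    intro u hu j
    have h := (hRK j u hu).2.1
    rw [← hLu u j] at h
    exact h
  have hLn : ∀ u j, matOpNorm (L u j - L 0 j) = ‖fderiv ℝ (B j) u - fderiv ℝ (B j) 0‖ := by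
    intro u j
    rw [matOpNorm, map_sub, map_sub, ← hLu u j, ← hLu 0 j]
    rfl
  have h0R : (0 : EuclideanSpace ℝ (Fin n)) ∈ Metric.ball 0 R := Metric.mem_ball_self hR
  -- nondegeneracy of the datum at the origin
  obtain ⟨c₀, hc₀, hc₀L⟩ : ∃ c₀ > (0 : ℝ), ∀ x, c₀ * ‖x‖ ^ 2 ≤
      ∑ j, p j * ‖matDatum (L 0) j x‖ ^ 2 := by
    have hθ : 0 < min δ₀ (1 / 2) / 2 := by positivity
    have hθ1 := min_le_left δ₀ (1 / 2)
    have hθ2 := min_le_right δ₀ (1 / 2)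
    obtain ⟨-, A, hA, hAn, -, hg, -⟩ := exists_nearly_extremal hp0 (L := L 0)
      (θ := min δ₀ (1 / 2) / 2) ⟨hθ, by linarith⟩
      (hN (L 0) (hLs 0 h0R) (fun j => (hLn 0 j).trans_lt (by rwa [sub_self, norm_zero])) _ ⟨hθ, by linarith⟩)
    exact exists_lower_bound hp0 hA hg (Real.rpow_pos_of_pos hθ _) hAn
  -- smallness of the scale
  set D := 4 * K + 1 with hD
  have hD0 : 0 < D := by positivity
  have hev : ∀ᶠ δ in nhdsWithin (0 : ℝ) (Set.Ioi 0), δ < 1 ∧ 3 * δ ^ α ≤ δ ∧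
      δ ^ (α * τ) ≤ min δ₀ (1 / 2) / 2 ∧ 2 * δ ^ (α * τ) ≤ δ ^ σ / 16 ∧
      3 * Real.pi * D ^ 2 * δ ^ (β - 2 * α * γ) ≤ 1 / (16 * (m + 1)) * δ ^ σ ∧
      Real.sqrt 2 ^ n * Real.exp (-(Real.pi * c₀ / 8 * δ ^ (-(2 * α * (γ - τ * N))))) ≤
        δ ^ σ / 16 := by
    filter_upwards [nhdsWithin_le_nhds (eventually_lt_nhds one_pos),
      eventually_mul_rpow_le (C := 3) one_pos hα1,
      eventually_mul_rpow_le (C := 1) (c := min δ₀ (1 / 2) / 2) (by positivity) hατ,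
      eventually_mul_rpow_le (C := 2) (c := 1 / 16) (by norm_num) hστ,
      eventually_mul_rpow_le (C := 3 * Real.pi * D ^ 2) (c := 1 / (16 * ((m : ℝ) + 1)))
        (by positivity) hσβ,
      eventually_mul_exp_neg_rpow_le (C := Real.sqrt 2 ^ n) (c := 1 / 16) (y := σ) (by norm_num)
        (by positivity : 0 < Real.pi * c₀ / 8) hgap] with δ h1 h2 h3 h4 h5 h6
    rw [Real.rpow_one, one_mul] at h2
    rw [Real.rpow_zero, one_mul, mul_one] at h3
    exact ⟨h1, h2, h3, by linarith, h5, by linarith⟩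
  obtain ⟨ν₁, hν₁, hsub⟩ := mem_nhdsGT_iff_exists_Ioo_subset.1 hev
  have hν₁0 : (0 : ℝ) < ν₁ := hν₁
  obtain ⟨ν₂, hν₂, hν₂R, hν₂η, hν₂c⟩ : ∃ ν > (0 : ℝ), 4 * ν < R ∧ K * ν < η ∧
      4 * (m * (K * ν) ^ 2) ≤ c₀ := by
    have hc : Filter.Tendsto (fun ν : ℝ => 4 * (m * (K * ν) ^ 2)) (nhdsWithin 0 (Set.Ioi 0))
        (nhds (4 * (m * (K * 0) ^ 2))) := Filter.Tendsto.mono_left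
      (Continuous.tendsto (by fun_prop) 0) nhdsWithin_le_nhds
    have hl : ∀ C : ℝ, Filter.Tendsto (fun ν : ℝ => C * ν) (nhdsWithin 0 (Set.Ioi 0))
        (nhds (C * 0)) := fun C => Filter.Tendsto.mono_left
      (Continuous.tendsto (by fun_prop) 0) nhdsWithin_le_nhds
    obtain ⟨ν, h1, h2, h3, h4⟩ := ((eventually_mem_nhdsWithin (a := (0 : ℝ)) (s := Set.Ioi 0)).and
      (((hl 4).eventually (gt_mem_nhds (by simpa using hR))).and
      (((hl K).eventually (gt_mem_nhds (by simpa using hη))).and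
      (hc.eventually (ge_mem_nhds (by simpa using hc₀)))))).exists
    exact ⟨ν, h1, h2, h3, h4⟩
  refine ⟨min ν₁ ν₂, lt_min hν₁0 hν₂, fun u hu κ hκ δ ⟨hδ0, hδν⟩ μ hμ hμδ => ?_⟩
  obtain ⟨hδν₁, hδν₂⟩ := lt_min_iff.1 hδν
  obtain ⟨hδ1, hαδ, hθδ, hθσ, hεσ, htail⟩ := hsub ⟨hδ0, hδν₁⟩
  have hu' : ‖u‖ ≤ ν₂ := (mem_closedBall_zero_iff.1 hu).trans (min_le_right _ _)
  have huR : ∀ x ∈ Metric.closedBall u (2 * δ), x ∈ Metric.ball 0 R := by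
    intro x hx
    rw [mem_ball_zero_iff]
    rw [Metric.mem_closedBall, dist_eq_norm] at hx
    linarith [norm_le_norm_add_norm_sub' x u]
  have hu2 : u ∈ Metric.closedBall u (2 * δ) := Metric.mem_closedBall_self (by linarith)
  have hLn' : ∀ j, ‖fderiv ℝ (B j) u - fderiv ℝ (B j) 0‖ ≤ K * ν₂ := by
    intro j
    refine ((hRK j u (huR u hu2)).2.2.2 0 h0R).2.trans ?_
    rw [sub_zero]
    exact mul_le_mul_of_nonneg_left hu' hK0.le
  have hmin1 := min_le_left δ₀ (1 / 2)
  have hmin2 := min_le_right δ₀ (1 / 2)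
  have hmin : 0 < min δ₀ (1 / 2) := by positivity
  have hθ0 : 0 < δ ^ (α * τ) := Real.rpow_pos_of_pos hδ0 _
  obtain ⟨hL, A, hA, hAn, hAn', hg, hθ⟩ := exists_nearly_extremal hp0 (L := L u)
    (θ := δ ^ (α * τ)) ⟨hθ0, by linarith⟩
    (hN (L u) (hLs u (huR u hu2))
      (fun j => (hLn u j).trans_lt ((hLn' j).trans_lt hν₂η)) _ ⟨hθ0, by linarith⟩)
  have hpow : ∀ {x y : ℝ}, y ≤ x → δ ^ x ≤ δ ^ y := fun h =>
    Real.rpow_le_rpow_of_exponent_ge hδ0 hδ1.le h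
  have hs0 : 0 < δ ^ σ := Real.rpow_pos_of_pos hδ0 _
  have hα0 : 0 < δ ^ α := Real.rpow_pos_of_pos hδ0 _
  have hαβ0 : 0 < δ ^ (α + β) := Real.rpow_pos_of_pos hδ0 _
  have hm : 2 * m * (1 / (16 * ((m : ℝ) + 1)) * δ ^ σ) ≤ δ ^ σ / 8 := by
    have : 2 * m * (1 / (16 * ((m : ℝ) + 1)) * δ ^ σ) = m / (m + 1) * (δ ^ σ / 8) := by
      field_simp
      ring
    rw [this]
    exact mul_le_of_le_one_left (by positivity) ((div_le_one (by positivity)).2 (by linarith))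
  have hm' : 1 / (16 * ((m : ℝ) + 1)) * δ ^ σ ≤ δ ^ σ := by
    refine mul_le_of_le_one_left hs0.le ((div_le_one (by positivity)).2 ?_)
    linarith [(Nat.cast_nonneg m : (0 : ℝ) ≤ m)]
  have hμd : μ ≤ D * δ ^ (α + β) := by
    rw [hD, add_mul, one_mul]
    have : 0 ≤ 4 * K * δ ^ (α + β) := by positivity
    linarith
  have hd₁ : 4 * K * δ ^ 2 ≤ D * δ ^ (α + β) := by
    have h := hpow (show α + β ≤ 2 by linarith)
    rw [Real.rpow_two] at h
    exact mul_le_mul (by linarith) h (sq_nonneg δ) hD0.le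
  have hd₂ : 2 * K * δ * δ ^ α ≤ D * δ ^ (α + β) := by
    have h := hpow (show α + β ≤ 1 + α by linarith)
    rw [Real.rpow_add hδ0, Real.rpow_one] at h
    rw [mul_assoc]
    exact mul_le_mul (by linarith) h (by positivity) hD0.le
  have hρ : 2 * K * δ ^ α + μ ≤ D * δ ^ α := by
    have h := hpow (show α ≤ α + β by linarith)
    rw [hD, add_mul, one_mul]
    have : 2 * K * δ ^ α ≤ 4 * K * δ ^ α :=
      mul_le_mul_of_nonneg_right (by linarith) hα0.le
    linarith
  have hε : Real.pi * (δ ^ (-(2 * α + 2 * α * γ - α * τ * N)) * (δ ^ (α * τ)) ^ (-(N : ℝ)) *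
      (D * δ ^ (α + β)) * (3 * (D * δ ^ α))) = 3 * Real.pi * D ^ 2 * δ ^ (β - 2 * α * γ) := by
    rw [← Real.rpow_mul hδ0.le]
    have : δ ^ (β - 2 * α * γ) = δ ^ (-(2 * α + 2 * α * γ - α * τ * N)) *
        δ ^ (α * τ * -N) * δ ^ (α + β) * δ ^ α := by
      rw [← Real.rpow_add hδ0, ← Real.rpow_add hδ0, ← Real.rpow_add hδ0]
      ring_nf
    rw [this]
    ring
  have htail' : Real.pi * (δ ^ (-(2 * α + 2 * α * γ - α * τ * N)) *
      (c₀ / 4 / (δ ^ (α * τ)) ^ (-(N : ℝ)))) * (δ ^ α) ^ 2 / 2 =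
      Real.pi * c₀ / 8 * δ ^ (-(2 * α * (γ - τ * N))) := by
    rw [← Real.rpow_mul hδ0.le]
    have : δ ^ (-(2 * α * (γ - τ * N))) = δ ^ (-(2 * α + 2 * α * γ - α * τ * N)) *
        (δ ^ (α * τ * -N))⁻¹ * (δ ^ α) ^ 2 := by
      rw [← Real.rpow_neg hδ0.le, ← Real.rpow_mul_natCast hδ0.le, ← Real.rpow_add hδ0,
        ← Real.rpow_add hδ0]
      push_cast
      ring_nf
    rw [this]
    ring
  rw [← htail'] at htail
  refine locC_le_of_nearly_extremal (r := δ ^ α) (d := D * δ ^ (α + β)) (ρ := D * δ ^ α)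
    (ε := 1 / (16 * ((m : ℝ) + 1)) * δ ^ σ) (t := δ ^ (-(2 * α + 2 * α * γ - α * τ * N)))
    (c₀ := c₀ / 4) hp (hLu u) hK0.le (fun j x hx => ?_)
    (fun j => (hRK j u (huR u hu2)).2.2.1) hL hA (Real.rpow_pos_of_pos hθ0 _) hAn hAn' hg hθ
    (by positivity) (lower_bound_of_near hp hc₀L (fun j => ?_) hν₂c) hα0 hαδ hμ hμd
    (by linarith) hd₁ hd₂ (mul_le_mul_of_nonneg_left (hpow (by linarith)) hD0.le) hρ
    (Real.rpow_pos_of_pos hδ0 _) (hε.le.trans hεσ) hs0.le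
    (Real.rpow_le_one hδ0.le hδ1.le hσ0.le) hm' hm hθ0.le hθσ htail
  · obtain ⟨h1, -, -, h2⟩ := hRK j x (huR x hx)
    exact ⟨h1, (h2 u (huR u hu2)).2, fun y hy => (h2 y (huR y hy)).1⟩
  · rw [hLu, hLu]
    exact hLn' j
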